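/- Suppose ν is minimal for (λ,μ), i.e., there exists a matrix in M(λ,μ) with π-sequence ν and no matrix in M(λ,μ) has π-sequence strictly dominated by ν. Then the number m_ν(λ,μ) of matrices in M(λ,μ) with π-sequence ν equals Σ_{α ⊵ λ, β ⊵ μ} K_{αλ} K_{βμ} k(α,β,ν). -/

import Mathlib

open Finset Equiv
open scoped Classical

noncomputable section

/-- Value at `g` of the permutation character of `S_n` induced from the trivial character of
the Young subgroup of the composition `c`: the number of colorings of `Fin n` with fiber
sizes given by `c` that are fixed by `g`. -/
def permChar (n : ℕ) (c : ℕ → ℕ) (g : Perm (Fin n)) : ℚ :=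
  Nat.card {f : Fin n → ℕ // (∀ k, Nat.card {x : Fin n // f x = k} = c k) ∧ ∀ x, f (g x) = f x}

/-- Inner product of class functions (real-valued characters) of `S_n`. -/
def innerChar (n : ℕ) (χ ψ : Perm (Fin n) → ℚ) : ℚ :=
  (∑ g : Perm (Fin n), χ g * ψ g) / (n.factorial : ℚ)

/-- The trivial character `χ^{(n)}` of `S_n`. -/
def trivChar (n : ℕ) : Perm (Fin n) → ℚ := fun _ => 1

/-- The sign character `χ^{(1^n)}` of `S_n`. -/
def signChar (n : ℕ) : Perm (Fin n) → ℚ := fun g => ((Perm.sign g : ℤ) : ℚ)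

/-- Permutation character for an integer vector: zero if some entry is negative. -/
def permCharZ (n : ℕ) (c : ℕ → ℤ) (g : Perm (Fin n)) : ℚ :=
  if ∀ k, 0 ≤ c k then permChar n (fun k => (c k).toNat) g else 0

/-- The irreducible character `χ^a` of `S_n` indexed by the partition `a`, given by the
Jacobi–Trudi determinantal formula `χ^a = ∑_σ sgn(σ) φ^{(a_i - i + σ(i))_i}`. -/
def irrChar (n : ℕ) (a : ℕ → ℕ) (g : Perm (Fin n)) : ℚ :=
  ∑ σ : Perm (Fin n), ((Perm.sign σ : ℤ) : ℚ) *
    permCharZ n (fun i => if h : i < n then (a i : ℤ) - i + ((σ ⟨i, h⟩ : Fin n) : ℕ) else 0) g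

/-- Kronecker coefficient `k(a,b,c) = ⟨χ^a ⊗ χ^b, χ^c⟩`. -/
def kron (n : ℕ) (a b c : ℕ → ℕ) : ℚ :=
  innerChar n (fun g => irrChar n a g * irrChar n b g) (irrChar n c)

/-- Extend a vector indexed by `Fin p` to `ℕ` by zeros. -/
def extc {p : ℕ} (l : Fin p → ℕ) : ℕ → ℕ := fun i => if h : i < p then l ⟨i, h⟩ else 0

/-- Dominance order: `a ⊵ b`. -/
def Dominates (a b : ℕ → ℕ) : Prop :=
  ∀ k, ∑ i ∈ Finset.range k, b i ≤ ∑ i ∈ Finset.range k, a i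

/-- Conjugate (transpose) of a partition with at most `n` parts. -/
def conjFun (n : ℕ) (a : ℕ → ℕ) : ℕ → ℕ :=
  fun j => ((Finset.range n).filter (fun i => j < a i)).card

/-- `a` is a partition of `n` (weakly decreasing, supported on the first `n` parts). -/
def IsPartitionFun (n : ℕ) (a : ℕ → ℕ) : Prop :=
  (∀ i j, i ≤ j → a j ≤ a i) ∧ (∀ i, n ≤ i → a i = 0) ∧ ∑ i ∈ Finset.range n, a i = n

/-- The weakly decreasing sequence of parts of `P : Nat.Partition n`. -/
def pf {n : ℕ} (P : n.Partition) : ℕ → ℕ :=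
  fun i => ((P.parts.sort (· ≤ ·)).reverse).getD i 0

/-- The parts of `P : Nat.Partition n` as a vector of length `n`. -/
def pfin {n : ℕ} (P : n.Partition) : Fin n → ℕ := fun k => pf P k

/-- Number of cells of the skew shape `a/b` where the filling `T` has entry `k`. -/
def skewContent (a b : ℕ → ℕ) (T : ℕ → ℕ → ℕ) (k : ℕ) : ℕ :=
  Nat.card {p : ℕ × ℕ // b p.1 ≤ p.2 ∧ p.2 < a p.1 ∧ T p.1 p.2 = k}

/-- Number of cells of the skew shape `a/b`. -/
def skewSize (a b : ℕ → ℕ) : ℕ :=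
  Nat.card {p : ℕ × ℕ // b p.1 ≤ p.2 ∧ p.2 < a p.1}

/-- `T` is a semistandard filling of the shape `a` (zero outside, rows weakly increasing,
columns strictly increasing). -/
def IsSSYT (a : ℕ → ℕ) (T : ℕ → ℕ → ℕ) : Prop :=
  (∀ i j, a i ≤ j → T i j = 0) ∧
  (∀ i j₁ j₂, j₁ ≤ j₂ → j₂ < a i → T i j₁ ≤ T i j₂) ∧
  (∀ i₁ i₂ j, i₁ < i₂ → j < a i₂ → T i₁ j < T i₂ j)

/-- The Kostka number: the number of semistandard Young tableaux of shape `a`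
and content `c`. -/
def kostka (a c : ℕ → ℕ) : ℕ :=
  Nat.card {T : ℕ → ℕ → ℕ // IsSSYT a T ∧ ∀ k, skewContent a (fun _ => 0) T k = c k}

/-- Number of entries equal to `k` in the prefix of the (right-to-left, top-to-bottom)
reading word of `T` ending at position `(i,j)`. -/
def lrCount (a b : ℕ → ℕ) (T : ℕ → ℕ → ℕ) (i j k : ℕ) : ℕ :=
  Nat.card {p : ℕ × ℕ //
    (p.1 < i ∨ (p.1 = i ∧ j ≤ p.2)) ∧ b p.1 ≤ p.2 ∧ p.2 < a p.1 ∧ T p.1 p.2 = k}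

/-- `T` is a Littlewood–Richardson skew tableau of shape `a/b`: semistandard and its
reverse reading word is a lattice word. -/
def IsLR (a b : ℕ → ℕ) (T : ℕ → ℕ → ℕ) : Prop :=
  (∀ i j, ¬(b i ≤ j ∧ j < a i) → T i j = 0) ∧
  (∀ i j₁ j₂, b i ≤ j₁ → j₁ ≤ j₂ → j₂ < a i → T i j₁ ≤ T i j₂) ∧
  (∀ i₁ i₂ j, i₁ < i₂ → b i₁ ≤ j → j < a i₁ → b i₂ ≤ j → j < a i₂ → T i₁ j < T i₂ j) ∧
  (∀ i j k, lrCount a b T i j (k + 1) ≤ lrCount a b T i j k)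

/-- A Littlewood–Richardson multitableau of shape `α` with `r` parts: a chain of
partitions `0 = α(0) ⊆ α(1) ⊆ ⋯ ⊆ α(r) = α` together with Littlewood–Richardson
fillings of the successive skew shapes. -/
structure LRMultiF (r : ℕ) (α : ℕ → ℕ) where
  chain : Fin (r + 1) → ℕ → ℕ
  antitone : ∀ k i j, i ≤ j → chain k j ≤ chain k i
  zero : ∀ i, chain 0 i = 0
  last : ∀ i, chain (Fin.last r) i = α i
  mono : ∀ (k : Fin r) (i : ℕ), chain k.castSucc i ≤ chain k.succ i
  T : Fin r → ℕ → ℕ → ℕ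
  lr : ∀ k : Fin r, IsLR (chain k.succ) (chain k.castSucc) (T k)

/-- Content of the `k`-th tableau of a Littlewood–Richardson multitableau. -/
def LRMultiF.cont {r : ℕ} {α : ℕ → ℕ} (M : LRMultiF r α) (k : Fin r) : ℕ → ℕ :=
  skewContent (M.chain k.succ) (M.chain k.castSucc) (M.T k)

/-- Size of the `k`-th tableau of a Littlewood–Richardson multitableau. -/
def LRMultiF.size {r : ℕ} {α : ℕ → ℕ} (M : LRMultiF r α) (k : Fin r) : ℕ :=
  skewSize (M.chain k.succ) (M.chain k.castSucc)

/-- `LR(α,β;ν)`: pairs of Littlewood–Richardson multitableaux of shapes `α`, `β`,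
type `ν`, with equal contents. -/
def LRPairs (r : ℕ) (α β : ℕ → ℕ) (ν : Fin r → ℕ) :=
  {TS : LRMultiF r α × LRMultiF r β //
    (∀ k, TS.1.size k = ν k) ∧ (∀ k, TS.2.size k = ν k) ∧ ∀ k, TS.1.cont k = TS.2.cont k}

/-- `LR*(α,β;ν)`: pairs of Littlewood–Richardson multitableaux of shapes `α`, `β`,
type `ν`, with termwise conjugate contents. -/
def LRPairsStar (n r : ℕ) (α β : ℕ → ℕ) (ν : Fin r → ℕ) :=
  {TS : LRMultiF r α × LRMultiF r β //
    (∀ k, TS.1.size k = ν k) ∧ (∀ k, TS.2.size k = ν k) ∧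
      ∀ k m, TS.2.cont k m = conjFun n (TS.1.cont k) m}

/-- `lr(α,β;ν)`. -/
def lrNum (r : ℕ) (α β : ℕ → ℕ) (ν : Fin r → ℕ) : ℕ := Nat.card (LRPairs r α β ν)

/-- `lr*(α,β;ν)`. -/
def lrStarNum (n r : ℕ) (α β : ℕ → ℕ) (ν : Fin r → ℕ) : ℕ :=
  Nat.card (LRPairsStar n r α β ν)

/-- A semistandard Young tableau (of arbitrary partition shape). -/
structure SSYTP where
  shape : ℕ → ℕ
  T : ℕ → ℕ → ℕ
  antitone : ∀ i j, i ≤ j → shape j ≤ shape i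
  finite : ∃ N, ∀ i, N ≤ i → shape i = 0
  ssyt : IsSSYT shape T

/-- Content of a semistandard Young tableau. -/
def SSYTP.cont (P : SSYTP) : ℕ → ℕ := skewContent P.shape (fun _ => 0) P.T

/-- The multiset of entries of a matrix. -/
def entriesM {p q : ℕ} (A : Fin p → Fin q → ℕ) : Multiset ℕ :=
  (Finset.univ : Finset (Fin p × Fin q)).val.map (fun ij => A ij.1 ij.2)

/-- The π-sequence of `A` is the partition `ν` (the weakly decreasing rearrangement of
the entries of `A` is `ν`). -/
def HasPiSeq {p q : ℕ} (A : Fin p → Fin q → ℕ) {n : ℕ} (ν : n.Partition) : Prop :=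
  (entriesM A).filter (· ≠ 0) = ν.parts

end

/-- The entry following position `i` in `v`, with the convention that `0` follows the last. -/
def nextEntry {n : ℕ} (v : Fin n → ℕ) (i : Fin n) : ℕ :=
  if h : (i : ℕ) + 1 < n then v ⟨i + 1, h⟩ else 0

/-- The number of `m`-rowed natural matrices with row sums `γ` and column sums `c`. -/
noncomputable def matCount {n : ℕ} (γ : ℕ → ℕ) : ℕ → (Fin n → ℤ) → ℤ
  | 0, c => if c = 0 then 1 else 0
  | m + 1, c => ∑ v ∈ Finset.piAntidiag Finset.univ (γ m), matCount γ m (fun i => c i - v i)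

/-- The antisymmetrization of `matCount`. -/
noncomputable def altCount {n : ℕ} (γ : ℕ → ℕ) (m : ℕ) (a : Fin n → ℤ) : ℤ :=
  ∑ σ : Perm (Fin n), (Perm.sign σ : ℤ) * matCount γ m (fun i => a i + ((σ i : ℕ) : ℤ))

/-- The number of chains of `m` horizontal strips of sizes `γ 0, …, γ (m - 1)` from the empty
shape to `ν`. -/
noncomputable def stripChains {n : ℕ} (γ : ℕ → ℕ) : ℕ → (Fin n → ℕ) → ℕ
  | 0, ν => if ν = 0 then 1 else 0
  | m + 1, ν => ∑ β ∈ (Fintype.piFinset fun i => Finset.Icc (nextEntry ν i) (ν i)) with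
      ∑ i, ν i = ∑ i, β i + γ m, stripChains γ m β

lemma matCount_comp_perm {n : ℕ} (γ : ℕ → ℕ) (m : ℕ) (c : Fin n → ℤ) (τ : Perm (Fin n)) :
    matCount γ m (c ∘ τ) = matCount γ m c := by
  induction m generalizing c with
  | zero =>
    have : c ∘ τ = 0 ↔ c = 0 := by
      constructor
      · intro h
        ext i
        simpa using congrFun h (τ.symm i)
      · rintro rfl
        rfl
    simp only [matCount, this]
  | succ m ih =>
    simp only [matCount]
    refine Finset.sum_nbij' (fun v => v ∘ τ.symm) (fun v => v ∘ τ) ?_ ?_ ?_ ?_ ?_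
    · intro v hv
      simp only [Finset.mem_piAntidiag, Finset.mem_univ, implies_true, and_true] at hv ⊢
      rw [← hv]
      exact Equiv.sum_comp τ.symm v
    · intro v hv
      simp only [Finset.mem_piAntidiag, Finset.mem_univ, implies_true, and_true] at hv ⊢
      rw [← hv]
      exact Equiv.sum_comp τ v
    · intro v _
      ext i
      simp
    · intro v _
      ext i
      simp
    · intro v _
      rw [← ih (fun i => c i - ((v ∘ τ.symm) i : ℕ))]
      congr 1
      ext i
      simp

lemma matCount_of_neg {n : ℕ} (γ : ℕ → ℕ) (m : ℕ) (c : Fin n → ℤ) (i : Fin n) (hi : c i < 0) :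
    matCount γ m c = 0 := by
  induction m generalizing c with
  | zero =>
    simp only [matCount]
    rw [if_neg]
    rintro rfl
    simp at hi
  | succ m ih =>
    simp only [matCount]
    exact Finset.sum_eq_zero fun v _ => ih _ (by omega)

lemma altCount_comp_perm {n : ℕ} (γ : ℕ → ℕ) (m : ℕ) (a : Fin n → ℤ) (τ : Perm (Fin n)) :
    altCount γ m (a ∘ τ) = (Perm.sign τ : ℤ) * altCount γ m a := by
  simp only [altCount]
  rw [Finset.mul_sum]
  refine Finset.sum_nbij' (fun σ => σ * τ⁻¹) (fun σ => σ * τ) (by simp) (by simp) (by simp)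
    (by simp) ?_
  intro σ _
  have h1 : (fun i => (a ∘ τ) i + ((σ i : ℕ) : ℤ)) =
      (fun i => a i + (((σ * τ⁻¹) i : ℕ) : ℤ)) ∘ τ := by
    ext i
    simp
  rw [h1, matCount_comp_perm, ← mul_assoc]
  congr 1
  rw [Perm.sign_mul, Perm.sign_inv]
  rcases Int.units_eq_one_or (Perm.sign τ) with h | h <;> simp [h]

lemma altCount_succ {n : ℕ} (γ : ℕ → ℕ) (m : ℕ) (a : Fin n → ℤ) :
    altCount γ (m + 1) a =
      ∑ v ∈ Finset.piAntidiag Finset.univ (γ m), altCount γ m (fun i => a i - v i) := by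
  simp only [altCount, matCount, Finset.mul_sum]
  rw [Finset.sum_comm]
  refine Finset.sum_congr rfl fun v _ => Finset.sum_congr rfl fun σ _ => ?_
  congr 2
  ext i
  ring

lemma altCount_of_lt {n : ℕ} (γ : ℕ → ℕ) (m : ℕ) (a : Fin n → ℤ) (i : Fin n)
    (hi : a i + (n - 1) < 0) : altCount γ m a = 0 := by
  refine Finset.sum_eq_zero fun σ _ => ?_
  rw [matCount_of_neg γ m _ i, mul_zero]
  have := (σ i).isLt
  omega

/-- `v` violates the horizontal strip condition for `ν` between rows `i` and `i + 1`. -/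
def StripViolation {n : ℕ} (ν v : Fin n → ℕ) (i : ℕ) : Prop :=
  ∃ h : i + 1 < n, ν ⟨i, by omega⟩ < ν ⟨i + 1, h⟩ + v ⟨i, by omega⟩

/-- Exchange of the rows `i` and `i + 1` of `ν - v` in the shifted sense. -/
def stripSwap {n : ℕ} (ν v : Fin n → ℕ) (i : ℕ) (h : i + 1 < n) : Fin n → ℕ := fun k =>
  if (k : ℕ) = i then ν ⟨i, by omega⟩ + 1 - ν ⟨i + 1, h⟩ + v ⟨i + 1, h⟩
  else if (k : ℕ) = i + 1 then ν ⟨i + 1, h⟩ + v ⟨i, by omega⟩ - ν ⟨i, by omega⟩ - 1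
  else v k

lemma stripSwap_comp {n : ℕ} {ν v : Fin n → ℕ} (hν : Antitone ν) {i : ℕ} (hi : i + 1 < n)
    (hv : ν ⟨i, by omega⟩ < ν ⟨i + 1, hi⟩ + v ⟨i, by omega⟩) :
    (fun k => (ν k : ℤ) - (k : ℕ) - stripSwap ν v i hi k) =
      (fun k => (ν k : ℤ) - (k : ℕ) - v k) ∘ Equiv.swap ⟨i, by omega⟩ ⟨i + 1, hi⟩ := by
  have hle : ν ⟨i + 1, hi⟩ ≤ ν ⟨i, by omega⟩ := hν (by simp [Fin.le_def])
  ext ⟨k, hk⟩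
  by_cases h1 : k = i
  · subst h1
    simp [stripSwap]
    omega
  · by_cases h2 : k = i + 1
    · subst h2
      simp [stripSwap]
      omega
    · have : Equiv.swap (⟨i, by omega⟩ : Fin n) ⟨i + 1, hi⟩ ⟨k, hk⟩ = ⟨k, hk⟩ :=
        Equiv.swap_apply_of_ne_of_ne (by simpa using h1) (by simpa using h2)
      simp [stripSwap, h1, h2, this]

lemma sum_stripSwap {n : ℕ} {ν v : Fin n → ℕ} (hν : Antitone ν) {i : ℕ} (hi : i + 1 < n)
    (hv : ν ⟨i, by omega⟩ < ν ⟨i + 1, hi⟩ + v ⟨i, by omega⟩) :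
    ∑ k, stripSwap ν v i hi k = ∑ k, v k := by
  have h := congrArg (fun f : Fin n → ℤ => ∑ k, f k) (stripSwap_comp hν hi hv)
  simp only [Function.comp_apply] at h
  rw [Equiv.sum_comp (Equiv.swap (⟨i, by omega⟩ : Fin n) ⟨i + 1, hi⟩)
    (fun k => (ν k : ℤ) - (k : ℕ) - v k)] at h
  simp only [Finset.sum_sub_distrib] at h
  have : (∑ k, (stripSwap ν v i hi k : ℤ)) = ∑ k, (v k : ℤ) := by linarith
  exact_mod_cast this

lemma stripViolation_stripSwap {n : ℕ} {ν v : Fin n → ℕ} (hν : Antitone ν) {i : ℕ}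
    (hi : i + 1 < n) : StripViolation ν (stripSwap ν v i hi) i := by
  have hle : ν ⟨i + 1, hi⟩ ≤ ν ⟨i, by omega⟩ := hν (by simp [Fin.le_def])
  refine ⟨hi, ?_⟩
  simp [stripSwap]
  omega

lemma stripViolation_stripSwap_iff {n : ℕ} {ν v : Fin n → ℕ} {i j : ℕ}
    (hi : i + 1 < n) (hj : j < i) :
    StripViolation ν (stripSwap ν v i hi) j ↔ StripViolation ν v j := by
  have h1 : j ≠ i := by omega
  have h2 : j ≠ i + 1 := by omega
  simp [StripViolation, stripSwap, h1, h2]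

lemma stripSwap_stripSwap {n : ℕ} {ν v : Fin n → ℕ} (hν : Antitone ν) {i : ℕ} (hi : i + 1 < n)
    (hv : ν ⟨i, by omega⟩ < ν ⟨i + 1, hi⟩ + v ⟨i, by omega⟩) :
    stripSwap ν (stripSwap ν v i hi) i hi = v := by
  have hle : ν ⟨i + 1, hi⟩ ≤ ν ⟨i, by omega⟩ := hν (by simp [Fin.le_def])
  ext ⟨k, hk⟩
  by_cases h1 : k = i
  · subst h1
    simp [stripSwap]
    omega
  · by_cases h2 : k = i + 1
    · subst h2
      simp [stripSwap]
      omega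
    · simp [stripSwap, h1, h2]

lemma sum_altCount_stripViolation {n : ℕ} (γ : ℕ → ℕ) (m r : ℕ) {ν : Fin n → ℕ}
    (hν : Antitone ν) :
    ∑ v ∈ Finset.piAntidiag Finset.univ r with ∃ i, StripViolation ν v i,
      altCount γ m (fun i => (ν i : ℤ) - (i : ℕ) - v i) = 0 := by
  have key : ∀ (v : Fin n → ℕ) (i : ℕ) (hi : i + 1 < n),
      ν ⟨i, by omega⟩ < ν ⟨i + 1, hi⟩ + v ⟨i, by omega⟩ →
      altCount γ m (fun k => (ν k : ℤ) - (k : ℕ) - stripSwap ν v i hi k) =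
        -altCount γ m (fun k => (ν k : ℤ) - (k : ℕ) - v k) := by
    intro v i hi hv
    rw [stripSwap_comp hν hi hv, altCount_comp_perm, Perm.sign_swap (by simp)]
    simp
  refine Finset.sum_involution
    (fun v hv => stripSwap ν v (Nat.find (Finset.mem_filter.1 hv).2)
      (Nat.find_spec (Finset.mem_filter.1 hv).2).1) ?_ ?_ ?_ ?_
  · intro v hv
    have h := Nat.find_spec (Finset.mem_filter.1 hv).2
    rw [key v _ h.1 h.2, add_neg_cancel]
  · intro v hv hne heq
    have h := Nat.find_spec (Finset.mem_filter.1 hv).2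
    have h2 := key v _ h.1 h.2
    rw [heq] at h2
    omega
  · intro v hv
    have h := Nat.find_spec (Finset.mem_filter.1 hv).2
    have hv' := hv
    simp only [Finset.mem_filter, Finset.mem_piAntidiag, Finset.mem_univ, implies_true,
      and_true] at hv' ⊢
    exact ⟨(sum_stripSwap hν h.1 h.2).trans hv'.1, _, stripViolation_stripSwap hν h.1⟩
  · intro v hv
    have hex := (Finset.mem_filter.1 hv).2
    have h := Nat.find_spec hex
    have hmin : ∀ (hex' : ∃ i, StripViolation ν (stripSwap ν v (Nat.find hex) h.1) i),
        Nat.find hex' = Nat.find hex := by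
      intro hex'
      rw [Nat.find_eq_iff]
      refine ⟨stripViolation_stripSwap hν h.1, fun j hj => ?_⟩
      rw [stripViolation_stripSwap_iff h.1 hj]
      exact Nat.find_min hex hj
    have hgen : ∀ (j : ℕ) (hj : j + 1 < n), j = Nat.find hex →
        stripSwap ν (stripSwap ν v (Nat.find hex) h.1) j hj = v := by
      rintro j hj rfl
      exact stripSwap_stripSwap hν h.1 h.2
    exact hgen _ _ (hmin _)

lemma altCount_zero {n : ℕ} (γ : ℕ → ℕ) {ν : Fin n → ℕ} (hν : Antitone ν) :
    altCount γ 0 (fun i => (ν i : ℤ) - (i : ℕ)) = if ν = 0 then 1 else 0 := by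
  have key : ∀ σ : Perm (Fin n),
      (fun i => (ν i : ℤ) - (i : ℕ) + ((σ i : ℕ) : ℤ)) = 0 → σ = 1 ∧ ν = 0 := by
    intro σ h
    have hi : ∀ i, (ν i : ℤ) - (i : ℕ) + ((σ i : ℕ) : ℤ) = 0 := fun i => congrFun h i
    have hmono : StrictMono σ := by
      intro i j hij
      have h1 := hi i
      have h2 := hi j
      have h3 := hν hij.le
      rw [Fin.lt_def] at hij ⊢
      omega
    have hσ : σ = 1 := by
      ext i
      have := congrFun (congrArg DFunLike.coe
        (Subsingleton.elim (hmono.orderIsoOfSurjective _ σ.surjective) (OrderIso.refl (Fin n)))) i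
      simpa using congrArg Fin.val this
    refine ⟨hσ, ?_⟩
    ext i
    have := hi i
    simp [hσ] at this
    simpa using this
  simp only [altCount, matCount]
  split_ifs with h0
  · subst h0
    rw [Finset.sum_eq_single 1]
    · simp [funext_iff]
    · intro σ _ hσ
      rw [if_neg, mul_zero]
      exact fun h => hσ (key σ h).1
    · simp
  · refine Finset.sum_eq_zero fun σ _ => ?_
    rw [if_neg, mul_zero]
    exact fun h => h0 (key σ h).2

lemma antitone_of_strip {n : ℕ} {ν β : Fin n → ℕ}
    (h : ∀ i, nextEntry ν i ≤ β i ∧ β i ≤ ν i) (hν : Antitone ν) : Antitone β := by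
  intro i j hij
  rcases hij.eq_or_lt with rfl | hij
  · exact le_rfl
  · rw [Fin.lt_def] at hij
    have h1 := (h i).1
    rw [nextEntry, dif_pos (by omega)] at h1
    exact (h j).2.trans ((hν (by simp [Fin.le_def]; omega)).trans h1)

theorem altCount_eq_stripChains {n : ℕ} (γ : ℕ → ℕ) (m : ℕ) {ν : Fin n → ℕ} (hν : Antitone ν) :
    altCount γ m (fun i => (ν i : ℤ) - (i : ℕ)) = stripChains γ m ν := by
  induction m generalizing ν with
  | zero =>
    rw [altCount_zero γ hν, stripChains]
    simp
  | succ m ih =>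
    rw [altCount_succ, ← Finset.sum_filter_add_sum_filter_not _
      (fun v => ∃ i, StripViolation ν v i), sum_altCount_stripViolation γ m _ hν, zero_add,
      ← Finset.sum_filter_add_sum_filter_not _ (fun v => ∃ i, ν i < v i)]
    have hz : ∀ v : Fin n → ℕ, (¬∃ i, StripViolation ν v i) → (∃ i, ν i < v i) →
        altCount γ m (fun i => (ν i : ℤ) - (i : ℕ) - v i) = 0 := by
      rintro v h1 ⟨i, hi⟩
      have hlast : ¬ (i : ℕ) + 1 < n := by
        intro h
        exact h1 ⟨i, h, by simp only [Fin.eta]; omega⟩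
      have := i.isLt
      exact altCount_of_lt γ m _ i (by omega)
    rw [Finset.sum_eq_zero, zero_add, stripChains, Nat.cast_sum]
    · refine Finset.sum_nbij' (fun v i => ν i - v i) (fun β i => ν i - β i) ?_ ?_ ?_ ?_ ?_
      · intro v hv
        simp only [Finset.mem_filter, Finset.mem_piAntidiag, Finset.mem_univ, implies_true,
          and_true, Fintype.mem_piFinset, Finset.mem_Icc, not_exists, not_lt] at hv ⊢
        obtain ⟨⟨h1, h2⟩, h3⟩ := hv
        refine ⟨fun i => ⟨?_, Nat.sub_le _ _⟩, ?_⟩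
        · unfold nextEntry
          split_ifs with h
          · have := h2 i
            simp only [StripViolation, not_exists, not_lt] at this
            have := this h
            simp only [Fin.eta] at this
            omega
          · exact Nat.zero_le _
        · rw [← h1, ← Finset.sum_add_distrib]
          exact Finset.sum_congr rfl fun i _ => by have := h3 i; omega
      · intro β hβ
        simp only [Finset.mem_filter, Finset.mem_piAntidiag, Finset.mem_univ, implies_true,
          and_true, Fintype.mem_piFinset, Finset.mem_Icc, not_exists, not_lt] at hβ ⊢
        obtain ⟨h1, h2⟩ := hβ
        refine ⟨⟨?_, ?_⟩, fun i => Nat.sub_le _ _⟩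
        · have : ∑ i, ν i = ∑ i, β i + ∑ i, (ν i - β i) := by
            rw [← Finset.sum_add_distrib]
            exact Finset.sum_congr rfl fun i _ => by have := (h1 i).2; omega
          omega
        · rintro i ⟨hi, h⟩
          have h3 := (h1 ⟨i, by omega⟩).1
          have h4 := (h1 ⟨i, by omega⟩).2
          simp only [nextEntry] at h3
          rw [dif_pos hi] at h3
          simp only at h
          omega
      · intro v hv
        simp only [Finset.mem_filter, not_exists, not_lt] at hv
        ext i
        have := hv.2 i
        simp only
        omega
      · intro β hβ
        simp only [Finset.mem_filter, Fintype.mem_piFinset, Finset.mem_Icc] at hβ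
        ext i
        have := (hβ.1 i).2
        simp only
        omega
      · intro v hv
        simp only [Finset.mem_filter, not_exists, not_lt] at hv
        rw [← ih]
        · congr 1
          ext i
          have := hv.2 i
          omega
        · refine antitone_of_strip (fun i => ⟨?_, Nat.sub_le _ _⟩) hν
          unfold nextEntry
          split_ifs with h
          · have := hv.1.2 i
            simp only [StripViolation, not_exists, not_lt] at this
            have := this h
            simp only [Fin.eta] at this
            omega
          · exact Nat.zero_le _
    · intro v hv
      simp only [Finset.mem_filter] at hv
      exact hz v hv.1.2 hv.2

lemma stripChains_ne_zero {n : ℕ} {γ : ℕ → ℕ} {m : ℕ} {ν : Fin n → ℕ}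
    (h : stripChains γ m ν ≠ 0) :
    (∀ i : Fin n, m ≤ i → ν i = 0) ∧ ∑ i, ν i = ∑ r ∈ Finset.range m, γ r ∧
      ∀ k ≤ m, ∑ r ∈ Finset.range k, γ r ≤
        ∑ i ∈ Finset.univ.filter (fun i : Fin n => (i : ℕ) < k), ν i := by
  induction m generalizing ν with
  | zero =>
    rw [stripChains] at h
    have : ν = 0 := by
      by_contra h0
      exact h (if_neg h0)
    subst this
    simp
  | succ m ih =>
    rw [stripChains] at h
    obtain ⟨β, hβ, hne⟩ := Finset.exists_ne_zero_of_sum_ne_zero h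
    simp only [Finset.mem_filter, Fintype.mem_piFinset, Finset.mem_Icc] at hβ
    obtain ⟨h1, h2, h3⟩ := ih hne
    have hz : ∀ i : Fin n, m + 1 ≤ i → ν i = 0 := by
      intro i hi
      have hb := (hβ.1 ⟨i - 1, by omega⟩).1
      rw [h1 ⟨i - 1, by omega⟩ (by simp only; omega), nextEntry,
        dif_pos (by simp only; omega)] at hb
      have : (⟨(i : ℕ) - 1 + 1, by omega⟩ : Fin n) = i := by
        ext
        simp only
        omega
      simp only [this] at hb
      omega
    refine ⟨hz, by rw [hβ.2, h2, Finset.sum_range_succ], fun k hk => ?_⟩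
    rcases hk.eq_or_lt with rfl | hk
    · rw [Finset.sum_range_succ, ← h2, ← hβ.2, Finset.sum_filter_of_ne]
      intro i _ hi
      by_contra hc
      exact hi (hz i (by omega))
    · exact (h3 k (by omega)).trans (Finset.sum_le_sum fun i _ => (hβ.1 i).2)

lemma sum_truncate {n m : ℕ} (γ : ℕ → ℕ) (hm : m ≤ n) :
    ∑ i : Fin n, (if (i : ℕ) < m then γ i else 0) = ∑ r ∈ Finset.range m, γ r := by
  rw [Fin.sum_univ_eq_sum_range (fun i => if i < m then γ i else 0), ← Finset.sum_filter]
  congr 1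
  ext i
  simp
  omega

lemma stripChains_self {n : ℕ} {γ : ℕ → ℕ} (hγ : Antitone γ) {m : ℕ} (hm : m ≤ n) :
    stripChains γ m (fun i : Fin n => if (i : ℕ) < m then γ i else 0) = 1 := by
  induction m with
  | zero =>
    rw [stripChains, if_pos]
    ext i
    simp
  | succ m ih =>
    rw [stripChains, Finset.sum_eq_single (fun i : Fin n => if (i : ℕ) < m then γ i else 0),
      ih (by omega)]
    · intro β hβ hne
      by_contra h0
      obtain ⟨h1, h2, -⟩ := stripChains_ne_zero h0
      simp only [Finset.mem_filter, Fintype.mem_piFinset, Finset.mem_Icc] at hβ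
      have hle : ∀ i ∈ Finset.univ, β i ≤ (fun i : Fin n => if (i : ℕ) < m then γ i else 0) i := by
        intro i _
        simp only
        split_ifs with hi
        · have := (hβ.1 i).2
          rwa [if_pos (by omega)] at this
        · rw [h1 i (by omega)]
      have := (Finset.sum_eq_sum_iff_of_le hle).1 (h2.trans (sum_truncate γ (by omega)).symm)
      exact hne (funext fun i => this i (Finset.mem_univ i))
    · intro h
      exfalso
      apply h
      simp only [Finset.mem_filter, Fintype.mem_piFinset, Finset.mem_Icc]
      refine ⟨fun i => ⟨?_, ?_⟩, ?_⟩
      · unfold nextEntry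
        simp only
        have := hγ (Nat.le_add_right (i : ℕ) 1)
        split_ifs <;> omega
      · split_ifs <;> omega
      · rw [sum_truncate γ hm, sum_truncate γ (by omega), Finset.sum_range_succ]

lemma matCount_eq_card {n : ℕ} (γ : ℕ → ℕ) (m : ℕ) (c : Fin n → ℤ) :
    matCount γ m c = Finset.card {A ∈ Fintype.piFinset fun r : Fin m =>
      Finset.piAntidiag (Finset.univ : Finset (Fin n)) (γ r) | ∀ j, ∑ r, (A r j : ℤ) = c j} := by
  induction m generalizing c with
  | zero =>
    rw [matCount]
    split_ifs with h
    · subst h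
      simp
    · have : ¬ ∀ j, 0 = c j := fun h' => h (funext fun j => (h' j).symm)
      simp [this]
  | succ m ih =>
    rw [matCount, Finset.card_eq_sum_card_fiberwise (f := fun A => A (Fin.last m))
      (t := Finset.piAntidiag Finset.univ (γ m))]
    · push_cast
      refine Finset.sum_congr rfl fun v hv => ?_
      rw [ih]
      norm_cast
      refine Finset.card_nbij' (fun A => Fin.snoc (α := fun _ => Fin n → ℕ) A v)
        (fun A => Fin.init A) ?_ ?_ ?_ ?_
      · intro A hA
        simp only [Finset.coe_filter, Fintype.mem_piFinset, Set.mem_ofPred_eq,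
          Finset.mem_filter] at hA ⊢
        refine ⟨⟨fun r => ?_, fun j => ?_⟩, by simp⟩
        · refine Fin.lastCases ?_ (fun r => ?_) r
          · simpa using hv
          · simpa using hA.1 r
        · rw [Fin.sum_univ_castSucc]
          simp [hA.2 j]
      · intro A hA
        simp only [Finset.coe_filter, Fintype.mem_piFinset, Set.mem_ofPred_eq,
          Finset.mem_filter] at hA ⊢
        refine ⟨fun r => by simpa [Fin.init] using hA.1.1 r.castSucc, fun j => ?_⟩
        have := hA.1.2 j
        rw [Fin.sum_univ_castSucc, hA.2] at this
        simp only [Fin.init]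
        omega
      · intro A _
        simp
      · intro A hA
        simp only [Finset.coe_filter, Set.mem_ofPred_eq] at hA
        rw [← hA.2]
        exact Fin.snoc_init_self A
    · intro A hA
      simp only [Finset.coe_filter, Fintype.mem_piFinset, Set.mem_ofPred_eq] at hA
      simpa using hA.1 (Fin.last m)

/-- The semistandard tableaux of shape `a` with entries below `m` and content `c`. -/
def ssytSet (a : ℕ → ℕ) (m : ℕ) (c : ℕ → ℕ) : Set (ℕ → ℕ → ℕ) :=
  {T | IsSSYT a T ∧ (∀ i j, j < a i → T i j < m) ∧
    ∀ k < m, skewContent a (fun _ => 0) T k = c k}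

/-- Extension of a filling of `b` to `a` by the entry `m`. -/
def fillStrip (a b : ℕ → ℕ) (m : ℕ) (T : ℕ → ℕ → ℕ) : ℕ → ℕ → ℕ := fun i j =>
  if j < b i then T i j else if j < a i then m else 0

lemma isSSYT_fillStrip {a b : ℕ → ℕ} {m : ℕ} {T : ℕ → ℕ → ℕ}
    (ha : Antitone a) (hba : ∀ i, b i ≤ a i)
    (hab : ∀ i, a (i + 1) ≤ b i) (hT : IsSSYT b T) (hm : ∀ i j, j < b i → T i j < m) :
    IsSSYT a (fillStrip a b m T) := by
  refine ⟨fun i j h => ?_, fun i j₁ j₂ h h2 => ?_, fun i₁ i₂ j h hj => ?_⟩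
  · have := hba i
    rw [fillStrip, if_neg (by omega), if_neg (by omega)]
  · unfold fillStrip
    have h3 := hT.2.1 i j₁ j₂ h
    have h4 := hm i j₁
    split_ifs <;> omega
  · have h1 : j < b i₁ := (hj.trans_le (ha h)).trans_le (hab i₁)
    have h2 := hT.2.2 i₁ i₂ j h
    have h3 := hm i₁ j h1
    unfold fillStrip
    rw [if_pos h1]
    split_ifs <;> omega

lemma skewContent_fillStrip_of_lt {a b : ℕ → ℕ} {m k : ℕ} {T : ℕ → ℕ → ℕ} (hba : ∀ i, b i ≤ a i)
    (hk : k < m) :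
    skewContent a (fun _ => 0) (fillStrip a b m T) k = skewContent b (fun _ => 0) T k := by
  refine Nat.card_congr (Equiv.subtypeEquivRight fun p => ?_)
  have := hba p.1
  unfold fillStrip
  constructor
  · rintro ⟨h1, h2, h3⟩
    split_ifs at h3 with h
    · exact ⟨h1, h, h3⟩
    · omega
  · rintro ⟨h1, h2, h3⟩
    exact ⟨h1, by omega, by rw [if_pos h2, h3]⟩

lemma skewSize_eq_sum {n : ℕ} {a b : ℕ → ℕ} (ha : ∀ i, n ≤ i → a i = 0) :
    skewSize a b = ∑ i ∈ Finset.range n, (a i - b i) := by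
  have h : ∀ p : ℕ × ℕ, (b p.1 ≤ p.2 ∧ p.2 < a p.1) ↔
      p ∈ (Finset.range n).biUnion fun i => (Finset.Ico (b i) (a i)).image (Prod.mk i) := by
    rintro ⟨i, j⟩
    simp only [Finset.mem_biUnion, Finset.mem_range, Finset.mem_image, Finset.mem_Ico,
      Prod.mk.injEq]
    constructor
    · intro h
      refine ⟨i, ?_, j, h, rfl, rfl⟩
      by_contra hc
      have := ha i (by omega)
      omega
    · rintro ⟨_, _, _, h, rfl, rfl⟩
      exact h
  rw [skewSize, Nat.subtype_card _ fun p => (h p).symm, Finset.card_biUnion]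
  · refine Finset.sum_congr rfl fun i _ => ?_
    rw [Finset.card_image_of_injective _ (Prod.mk_right_injective i), Nat.card_Ico]
  · intro i _ j _ hij
    rw [Function.onFun, Finset.disjoint_left]
    simp only [Finset.mem_image, not_exists]
    rintro _ ⟨x, _, rfl⟩ y ⟨_, h⟩
    exact hij (Prod.mk.inj h).1.symm

lemma skewContent_fillStrip_self {a b : ℕ → ℕ} {m : ℕ} {T : ℕ → ℕ → ℕ}
    (hm : ∀ i j, j < b i → T i j < m) :
    skewContent a (fun _ => 0) (fillStrip a b m T) m = skewSize a b := by
  refine Nat.card_congr (Equiv.subtypeEquivRight fun p => ?_)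
  unfold fillStrip
  constructor
  · rintro ⟨h1, h2, h3⟩
    split_ifs at h3 with h
    · exact absurd h3 (hm _ _ h).ne
    · exact ⟨not_lt.1 h, h2⟩
  · rintro ⟨h1, h2⟩
    exact ⟨Nat.zero_le _, h2, by rw [if_neg (by omega), if_pos h2]⟩

lemma lt_iff_of_fillStrip {a b : ℕ → ℕ} {m : ℕ} {T : ℕ → ℕ → ℕ} (hba : ∀ i, b i ≤ a i)
    (hm : ∀ i j, j < b i → T i j < m) (i j : ℕ) :
    j < b i ↔ j < a i ∧ fillStrip a b m T i j < m := by
  have := hba i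
  unfold fillStrip
  constructor
  · intro h
    exact ⟨by omega, by rw [if_pos h]; exact hm i j h⟩
  · rintro ⟨h1, h2⟩
    by_contra h
    rw [if_neg h, if_pos h1] at h2
    omega

/-- The length of row `i` of the shape formed by the entries of `T` below `m`. -/
def rowBelow (a : ℕ → ℕ) (m : ℕ) (T : ℕ → ℕ → ℕ) (i : ℕ) : ℕ :=
  ((Finset.range (a i)).filter fun j => T i j < m).card

lemma lt_rowBelow_iff {a : ℕ → ℕ} {m : ℕ} {T : ℕ → ℕ → ℕ} (hT : IsSSYT a T) (i j : ℕ) :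
    j < rowBelow a m T i ↔ j < a i ∧ T i j < m := by
  constructor
  · intro h
    by_contra hc
    have hsub : (Finset.range (a i)).filter (fun j => T i j < m) ⊆ Finset.range j := by
      intro j' hj'
      simp only [Finset.mem_filter, Finset.mem_range] at hj' ⊢
      by_contra hlt
      have := hT.2.1 i j j' (by omega) hj'.1
      omega
    have := Finset.card_le_card hsub
    rw [Finset.card_range] at this
    unfold rowBelow at h
    omega
  · rintro ⟨h1, h2⟩
    have hsub : Finset.range (j + 1) ⊆ (Finset.range (a i)).filter (fun j => T i j < m) := by
      intro j' hj'
      simp only [Finset.mem_filter, Finset.mem_range] at hj' ⊢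
      have := hT.2.1 i j' j (by omega) h1
      omega
    have := Finset.card_le_card hsub
    rw [Finset.card_range] at this
    unfold rowBelow
    omega

/-- The filling `T` restricted to the shape `b`. -/
def restrictFilling (b : ℕ → ℕ) (T : ℕ → ℕ → ℕ) : ℕ → ℕ → ℕ := fun i j =>
  if j < b i then T i j else 0

lemma fillStrip_restrictFilling {a b : ℕ → ℕ} {m : ℕ} {T : ℕ → ℕ → ℕ}
    (hT : IsSSYT a T) (hm : ∀ i j, j < a i → T i j < m + 1)
    (hb : ∀ i j, j < b i ↔ j < a i ∧ T i j < m) :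
    fillStrip a b m (restrictFilling b T) = T := by
  ext i j
  unfold fillStrip restrictFilling
  have h1 := hb i j
  have h2 := hm i j
  have h3 := hT.1 i j
  split_ifs <;> omega

lemma isSSYT_restrictFilling {a b : ℕ → ℕ} {T : ℕ → ℕ → ℕ} (hT : IsSSYT a T) (hba : ∀ i, b i ≤ a i)
    (hb : Antitone b) : IsSSYT b (restrictFilling b T) := by
  refine ⟨fun i j h => if_neg (by omega), fun i j₁ j₂ h h2 => ?_, fun i₁ i₂ j h hj => ?_⟩
  · have := hba i
    unfold restrictFilling
    rw [if_pos (by omega), if_pos h2]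
    exact hT.2.1 i j₁ j₂ h (by omega)
  · have h1 := hba i₂
    have h2 := hb h.le
    unfold restrictFilling
    rw [if_pos (by omega), if_pos hj]
    exact hT.2.2 i₁ i₂ j h (by omega)

lemma extc_of_lt {n : ℕ} (ν : Fin n → ℕ) {i : ℕ} (h : i < n) : extc ν i = ν ⟨i, h⟩ := dif_pos h

lemma extc_of_le {n : ℕ} (ν : Fin n → ℕ) {i : ℕ} (h : n ≤ i) : extc ν i = 0 :=
  dif_neg (by omega)

lemma extc_val {n : ℕ} (ν : Fin n → ℕ) (i : Fin n) : extc ν i = ν i := dif_pos i.isLt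

lemma antitone_extc {n : ℕ} {ν : Fin n → ℕ} (hν : Antitone ν) : Antitone (extc ν) := by
  intro i j hij
  by_cases h : j < n
  · rw [extc_of_lt ν h, extc_of_lt ν (by omega)]
    exact hν (by simpa [Fin.le_def] using hij)
  · rw [extc_of_le ν (by omega)]
    exact Nat.zero_le _

lemma extc_succ {n : ℕ} (ν : Fin n → ℕ) (i : Fin n) : extc ν (i + 1) = nextEntry ν i := rfl

lemma strip_iff {n : ℕ} {ν β : Fin n → ℕ} :
    (∀ i, nextEntry ν i ≤ β i ∧ β i ≤ ν i) ↔
      (∀ i, extc ν (i + 1) ≤ extc β i) ∧ ∀ i, extc β i ≤ extc ν i := by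
  constructor
  · intro h
    refine ⟨fun i => ?_, fun i => ?_⟩
    · by_cases hi : i < n
      · rw [extc_of_lt β hi]
        exact (h ⟨i, hi⟩).1
      · rw [extc_of_le ν (by omega)]
        exact Nat.zero_le _
    · by_cases hi : i < n
      · rw [extc_of_lt β hi, extc_of_lt ν hi]
        exact (h ⟨i, hi⟩).2
      · rw [extc_of_le β (by omega)]
        exact Nat.zero_le _
  · rintro ⟨h1, h2⟩ i
    refine ⟨?_, ?_⟩
    · rw [← extc_succ, ← extc_val β]
      exact h1 i
    · rw [← extc_val β, ← extc_val ν]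
      exact h2 i

lemma skewSize_extc {n : ℕ} {ν β : Fin n → ℕ} (h : ∀ i, extc β i ≤ extc ν i) :
    ∑ i, ν i = ∑ i, β i + skewSize (extc ν) (extc β) := by
  rw [skewSize_eq_sum (n := n) (fun i hi => extc_of_le ν hi),
    ← Fin.sum_univ_eq_sum_range (fun i => extc ν i - extc β i), ← Finset.sum_add_distrib]
  refine Finset.sum_congr rfl fun i _ => ?_
  have := h i
  simp only [extc_val] at this ⊢
  omega

lemma card_ssytSet {n : ℕ} (c : ℕ → ℕ) (m : ℕ) {ν : Fin n → ℕ} (hν : Antitone ν) :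
    Finite (ssytSet (extc ν) m c) ∧ Nat.card (ssytSet (extc ν) m c) = stripChains c m ν := by
  induction m generalizing ν with
  | zero =>
    rw [stripChains]
    split_ifs with h0
    · have : ssytSet (extc ν) 0 c = {fun _ _ => 0} := by
        have hz : ∀ i, extc ν i = 0 := by
          intro i
          subst h0
          unfold extc
          split_ifs <;> rfl
        ext T
        simp only [ssytSet, IsSSYT, hz, Set.mem_ofPred_eq, Set.mem_singleton_iff]
        constructor
        · rintro ⟨⟨h, -⟩, -⟩
          ext i j
          exact h i j (Nat.zero_le _)
        · rintro rfl
          simp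
      rw [this]
      exact ⟨inferInstance, by simp⟩
    · have : ssytSet (extc ν) 0 c = ∅ := by
        rw [Set.eq_empty_iff_forall_notMem]
        rintro T ⟨-, h, -⟩
        apply h0
        ext i
        by_contra hi
        exact absurd (h i 0 (by rw [extc_val]; exact Nat.pos_of_ne_zero hi)) (by simp)
      rw [this]
      exact ⟨inferInstance, by simp⟩
  | succ m ih =>
    set S : Finset (Fin n → ℕ) :=
      (Fintype.piFinset fun i => Finset.Icc (nextEntry ν i) (ν i)).filter
      (fun β => ∑ i, ν i = ∑ i, β i + c m) with hS
    have hmem : ∀ β, β ∈ S ↔ (∀ i, nextEntry ν i ≤ β i ∧ β i ≤ ν i) ∧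
        ∑ i, ν i = ∑ i, β i + c m := by
      intro β
      simp [hS]
    have hanti : ∀ β : S, Antitone β.1 := fun β => antitone_of_strip ((hmem β.1).1 β.2).1 hν
    let F : (Σ β : S, ssytSet (extc β.1) m c) → ssytSet (extc ν) (m + 1) c := fun x =>
      ⟨fillStrip (extc ν) (extc x.1.1) m x.2.1, by
        obtain ⟨⟨β, hβ⟩, T, hT, hTm, hTc⟩ := x
        obtain ⟨h1, h2⟩ := (hmem β).1 hβ
        obtain ⟨h3, h4⟩ := strip_iff.1 h1
        refine ⟨isSSYT_fillStrip (antitone_extc hν) h4 h3 hT hTm, fun i j hj => ?_,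
          fun k hk => ?_⟩
        · have : j < extc β i → T i j < m := hTm i j
          simp only [fillStrip]
          split_ifs <;> omega
        · rcases Nat.lt_succ_iff_lt_or_eq.1 hk with hk | rfl
          · rw [skewContent_fillStrip_of_lt h4 hk, hTc k hk]
          · rw [skewContent_fillStrip_self hTm]
            exact Nat.add_left_cancel ((skewSize_extc h4).symm.trans h2)⟩
    have hF : Function.Bijective F := by
      constructor
      · rintro ⟨⟨β, hβ⟩, T, hT, hTm, hTc⟩ ⟨⟨β', hβ'⟩, T', hT', hTm', hTc'⟩ heq
        have heq' : fillStrip (extc ν) (extc β) m T = fillStrip (extc ν) (extc β') m T' :=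
          congrArg Subtype.val heq
        have h4 := (strip_iff.1 ((hmem β).1 hβ).1).2
        have h4' := (strip_iff.1 ((hmem β').1 hβ').1).2
        have hββ : β = β' := by
          ext i
          rw [← extc_val β, ← extc_val β']
          refine eq_of_forall_lt_iff fun j => ?_
          rw [lt_iff_of_fillStrip h4 hTm, lt_iff_of_fillStrip h4' hTm', heq']
        subst hββ
        have hTT : T = T' := by
          ext i j
          by_cases hj : j < extc β i
          · have := congrFun (congrFun heq' i) j
            simpa [fillStrip, hj] using this
          · rw [hT.1 i j (not_lt.1 hj), hT'.1 i j (not_lt.1 hj)]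
        subst hTT
        rfl
      · rintro ⟨T, hT, hTm, hTc⟩
        have hb := lt_rowBelow_iff (m := m) hT
        have hle : ∀ i, rowBelow (extc ν) m T i ≤ extc ν i := fun i =>
          le_of_forall_lt fun j hj => ((hb i j).1 hj).1
        set β : Fin n → ℕ := fun i => rowBelow (extc ν) m T i with hβdef
        have hext : extc β = rowBelow (extc ν) m T := by
          ext i
          by_cases hi : i < n
          · rw [extc_of_lt β hi]
          · have := hle i
            rw [extc_of_le ν (by omega)] at this
            rw [extc_of_le β (by omega)]
            omega
        rw [← hext] at hb hle
        have h3 : ∀ i, extc ν (i + 1) ≤ extc β i := by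
          intro i
          refine le_of_forall_lt fun j hj => (hb i j).2 ⟨?_, ?_⟩
          · exact hj.trans_le (antitone_extc hν (Nat.le_succ i))
          · have h5 := hT.2.2 i (i + 1) j (Nat.lt_succ_self i) hj
            have h6 := hTm (i + 1) j hj
            omega
        have hanti' : Antitone (extc β) :=
          antitone_extc (antitone_of_strip (strip_iff.2 ⟨h3, hle⟩) hν)
        have hfill := fillStrip_restrictFilling hT hTm hb
        have hrm : ∀ i j, j < extc β i → restrictFilling (extc β) T i j < m := by
          intro i j hj
          rw [restrictFilling, if_pos hj]
          exact ((hb i j).1 hj).2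
        have hβS : β ∈ S := by
          refine (hmem β).2 ⟨strip_iff.2 ⟨h3, hle⟩, ?_⟩
          rw [skewSize_extc hle, ← hTc m (Nat.lt_succ_self m)]
          conv_rhs => rw [← hfill]
          rw [skewContent_fillStrip_self hrm]
        refine ⟨⟨⟨β, hβS⟩, restrictFilling (extc β) T,
          isSSYT_restrictFilling hT hle hanti', hrm, fun k hk => ?_⟩, Subtype.ext hfill⟩
        rw [← hTc k (by omega)]
        conv_rhs => rw [← hfill]
        rw [skewContent_fillStrip_of_lt hle hk]
    have : ∀ β : S, Finite (ssytSet (extc β.1) m c) := fun β => (ih (hanti β)).1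
    refine ⟨Finite.of_surjective F hF.2, ?_⟩
    rw [← Nat.card_congr (Equiv.ofBijective F hF), Nat.card_sigma, stripChains, ← hS,
      ← Finset.sum_coe_sort S]
    exact Finset.sum_congr rfl fun β _ => (ih (hanti β)).2

theorem kostka_extc {n : ℕ} {c : ℕ → ℕ} (hc : ∀ k, n ≤ k → c k = 0) {ν : Fin n → ℕ}
    (hν : Antitone ν) : kostka (extc ν) c = stripChains c n ν := by
  rw [← (card_ssytSet c n hν).2]
  refine Nat.card_congr (Equiv.subtypeEquivRight fun T => ?_)
  constructor
  · rintro ⟨hT, hTc⟩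
    refine ⟨hT, fun i j hj => ?_, fun k _ => hTc k⟩
    by_contra hlt
    have h0 := hTc (T i j)
    rw [hc _ (by omega), skewContent, Nat.card_eq_zero] at h0
    rcases h0 with h0 | h0
    · exact h0.elim ⟨(i, j), Nat.zero_le _, hj, rfl⟩
    · refine h0.not_finite (Set.Finite.subset
        ((Set.finite_Iio n).prod (Set.finite_Iio (extc ν 0))) ?_)
      rintro ⟨i', j'⟩ ⟨-, h, -⟩
      simp only [Set.mem_prod, Set.mem_Iio]
      refine ⟨?_, h.trans_le (antitone_extc hν (Nat.zero_le i'))⟩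
      by_contra hi
      rw [extc_of_le ν (by omega)] at h
      omega
  · rintro ⟨hT, hTm, hTc⟩
    refine ⟨hT, fun k => ?_⟩
    by_cases hk : k < n
    · exact hTc k hk
    · rw [hc k (by omega), skewContent, Nat.card_eq_zero]
      left
      refine ⟨?_⟩
      rintro ⟨⟨i, j⟩, -, h, h'⟩
      have := hTm i j h
      simp only at h'
      omega

/-- The number of colorings of `Fin n` by `ι` with fiber sizes `c` that are fixed by `g`. -/
noncomputable def colorChar (n : ℕ) {ι : Type*} (c : ι → ℕ) (g : Perm (Fin n)) : ℚ :=
  Nat.card {f : Fin n → ι // (∀ k, Nat.card {x : Fin n // f x = k} = c k) ∧ ∀ x, f (g x) = f x}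

lemma colorChar_comp_embedding {n : ℕ} {ι κ : Type*} (e : ι ↪ κ) (c : κ → ℕ)
    (hc : ∀ k, k ∉ Set.range e → c k = 0) (g : Perm (Fin n)) :
    colorChar n (c ∘ e) g = colorChar n c g := by
  unfold colorChar
  congr 1
  refine Nat.card_congr (Equiv.ofBijective (fun f => ⟨e ∘ f.1, fun k => ?_, fun x => ?_⟩) ⟨?_, ?_⟩)
  · by_cases hk : k ∈ Set.range e
    · obtain ⟨i, rfl⟩ := hk
      rw [← Function.comp_apply (f := c), ← f.2.1 i]
      exact Nat.card_congr (Equiv.subtypeEquivRight fun x => e.injective.eq_iff)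
    · rw [hc k hk, Nat.card_eq_zero]
      exact Or.inl ⟨fun x => hk ⟨_, x.2⟩⟩
  · exact congrArg e (f.2.2 x)
  · intro f f' h
    ext x
    exact e.injective (congrFun (congrArg Subtype.val h) x)
  · rintro ⟨f, hf, hg⟩
    have hr : ∀ x, ∃ i, e i = f x := by
      intro x
      by_contra hx
      have h0 := hc (f x) hx
      rw [← hf, Nat.card_eq_zero] at h0
      rcases h0 with h0 | h0
      · exact h0.elim ⟨x, rfl⟩
      · exact h0.not_finite inferInstance
    choose f' hf' using hr
    have hcomp : e ∘ f' = f := funext hf'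
    refine ⟨⟨f', fun k => ?_, fun x => ?_⟩, Subtype.ext hcomp⟩
    · rw [Function.comp_apply, ← hf]
      refine Nat.card_congr (Equiv.subtypeEquivRight fun x => ?_)
      rw [← hf', e.injective.eq_iff]
    · apply e.injective
      rw [hf', hf', hg]

lemma exists_equiv_of_parts_eq {ι κ : Type*} [Fintype ι] [Fintype κ] {c : ι → ℕ} {d : κ → ℕ}
    (h : (Finset.univ.val.map c).filter (· ≠ 0) = (Finset.univ.val.map d).filter (· ≠ 0)) :
    ∃ e : {i // c i ≠ 0} ≃ {k // d k ≠ 0}, ∀ i, d (e i) = c i := by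
  have hcard : ∀ v,
      Nonempty ({a : {i // c i ≠ 0} // c a = v} ≃ {b : {k // d k ≠ 0} // d b = v}) := by
    intro v
    by_cases hv : v = 0
    · subst hv
      have h1 : IsEmpty {a : {i // c i ≠ 0} // c a = 0} := ⟨fun a => a.1.2 a.2⟩
      have h2 : IsEmpty {b : {k // d k ≠ 0} // d b = 0} := ⟨fun b => b.1.2 b.2⟩
      exact ⟨Equiv.equivOfIsEmpty _ _⟩
    · have h1 := congrArg (Multiset.count v) h
      rw [Multiset.count_filter_of_pos (p := (· ≠ 0)) hv,
        Multiset.count_filter_of_pos (p := (· ≠ 0)) hv, Multiset.count_map,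
        Multiset.count_map] at h1
      have h2 : Fintype.card {i // c i = v} = Fintype.card {k // d k = v} := by
        rw [Fintype.card_subtype, Fintype.card_subtype]
        simpa [Finset.card, Finset.filter, eq_comm] using h1
      have h3 : {a : {i // c i ≠ 0} // c a = v} ≃ {i // c i = v} :=
        Equiv.subtypeSubtypeEquivSubtype (p := fun i => c i ≠ 0) (q := fun i => c i = v)
          (fun {x} hx => by rw [hx]; exact hv)
      have h4 : {b : {k // d k ≠ 0} // d b = v} ≃ {k // d k = v} :=
        Equiv.subtypeSubtypeEquivSubtype (p := fun k => d k ≠ 0) (q := fun k => d k = v)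
          (fun {x} hx => by rw [hx]; exact hv)
      exact ⟨(h3.trans (Fintype.equivOfCardEq h2)).trans h4.symm⟩
  have E := fun v => (hcard v).some
  exact ⟨Equiv.ofFiberEquiv (f := fun i : {i // c i ≠ 0} => c i)
    (g := fun k : {k // d k ≠ 0} => d k) E, fun i => Equiv.ofFiberEquiv_map E i⟩

lemma colorChar_eq_of_parts_eq {n : ℕ} {ι κ : Type*} [Fintype ι] [Fintype κ] {c : ι → ℕ}
    {d : κ → ℕ}
    (h : (Finset.univ.val.map c).filter (· ≠ 0) = (Finset.univ.val.map d).filter (· ≠ 0)) :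
    colorChar n c = colorChar n d := by
  obtain ⟨e, he⟩ := exists_equiv_of_parts_eq h
  ext g
  rw [← colorChar_comp_embedding (Function.Embedding.subtype fun i => c i ≠ 0) c (by simp),
    ← colorChar_comp_embedding (Function.Embedding.subtype fun k => d k ≠ 0) d (by simp),
    ← colorChar_comp_embedding e.toEmbedding _ (by simp)]
  congr 1
  ext i
  exact (he i).symm

/-- The matrices with row sums `c` and column sums `d`. -/
def marginSet {n : ℕ} (c d : Fin n → ℕ) : Finset (Fin n → Fin n → ℕ) :=
  {A ∈ Fintype.piFinset fun r => Finset.piAntidiag (Finset.univ : Finset (Fin n)) (c r) |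
    ∀ j, ∑ r, A r j = d j}

lemma mem_marginSet {n : ℕ} {c d : Fin n → ℕ} {A : Fin n → Fin n → ℕ} :
    A ∈ marginSet c d ↔ (∀ i, ∑ j, A i j = c i) ∧ ∀ j, ∑ i, A i j = d j := by
  simp [marginSet]

lemma card_fiber_fst {n : ℕ} {ι κ : Type*} [Fintype κ] (f : Fin n → ι × κ) (i : ι) :
    ∑ j, Nat.card {x // f x = (i, j)} = Nat.card {x // (f x).1 = i} := by
  rw [← Nat.card_sigma]
  refine Nat.card_congr ⟨fun y => ⟨y.2.1, by rw [y.2.2]⟩,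
    fun x => ⟨(f x.1).2, x.1, Prod.ext x.2 rfl⟩, ?_, fun _ => rfl⟩
  rintro ⟨j, x, hx⟩
  have : j = (f x).2 := by rw [hx]
  subst this
  rfl

lemma card_fiber_snd {n : ℕ} {ι κ : Type*} [Fintype ι] (f : Fin n → ι × κ) (j : κ) :
    ∑ i, Nat.card {x // f x = (i, j)} = Nat.card {x // (f x).2 = j} := by
  rw [← Nat.card_sigma]
  refine Nat.card_congr ⟨fun y => ⟨y.2.1, by rw [y.2.2]⟩,
    fun x => ⟨(f x.1).1, x.1, Prod.ext rfl x.2⟩, ?_, fun _ => rfl⟩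
  rintro ⟨j, x, hx⟩
  have : j = (f x).1 := by rw [hx]
  subst this
  rfl

lemma colorChar_mul {n : ℕ} (c d : Fin n → ℕ) (g : Perm (Fin n)) :
    colorChar n c g * colorChar n d g =
      ∑ A ∈ marginSet c d, colorChar n (Function.uncurry A) g := by
  unfold colorChar
  norm_cast
  rw [← Nat.card_prod, ← Finset.sum_coe_sort (marginSet c d), ← Nat.card_sigma]
  refine Nat.card_congr ⟨fun p => ⟨⟨fun i j => Nat.card {x // (p.1.1 x, p.2.1 x) = (i, j)}, ?_⟩,
    fun x => (p.1.1 x, p.2.1 x), fun k => rfl, fun x => ?_⟩,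
    fun q => ⟨⟨fun x => (q.2.1 x).1, fun i => ?_, fun x => congrArg Prod.fst (q.2.2.2 x)⟩,
      ⟨fun x => (q.2.1 x).2, fun i => ?_, fun x => congrArg Prod.snd (q.2.2.2 x)⟩⟩, ?_, ?_⟩
  · rw [mem_marginSet]
    refine ⟨fun i => ?_, fun j => ?_⟩
    · rw [← p.1.2.1 i]
      exact card_fiber_fst (fun x => (p.1.1 x, p.2.1 x)) i
    · rw [← p.2.2.1 j]
      exact card_fiber_snd (fun x => (p.1.1 x, p.2.1 x)) j
  · simp only
    rw [p.1.2.2, p.2.2.2]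
  · rw [← card_fiber_fst, ← (mem_marginSet.1 q.1.2).1 i]
    exact Finset.sum_congr rfl fun j _ => q.2.2.1 (i, j)
  · rw [← card_fiber_snd, ← (mem_marginSet.1 q.1.2).2 i]
    exact Finset.sum_congr rfl fun j _ => q.2.2.1 (j, i)
  · intro p
    rfl
  · rintro ⟨⟨A, hA⟩, f, hf, hg⟩
    have : A = fun i j => Nat.card {x // f x = (i, j)} := by
      ext i j
      exact (hf (i, j)).symm
    subst this
    rfl

lemma exists_coloring {n : ℕ} {ι : Type*} [Fintype ι] {c : ι → ℕ} (hc : ∑ i, c i = n) :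
    ∃ f : Fin n → ι, ∀ k, Nat.card {x // f x = k} = c k := by
  have hcard : Fintype.card (Fin n) = Fintype.card (Σ i, Fin (c i)) := by simp [hc]
  obtain ⟨e⟩ := Fintype.card_eq.1 hcard
  refine ⟨fun x => (e x).1, fun k => ?_⟩
  rw [Nat.card_congr (e.subtypeEquiv (q := fun y => y.1 = k) fun x => Iff.rfl),
    Nat.card_congr (Equiv.sigmaSubtype k), Nat.card_eq_fintype_card, Fintype.card_fin]

lemma sum_colorChar {n : ℕ} {ι : Type*} [Fintype ι] {c : ι → ℕ} (hc : ∑ i, c i = n) :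
    ∑ g, colorChar n c g = n.factorial := by
  obtain ⟨f₀, hf₀⟩ := exists_coloring hc
  have hperm : ∀ f : Fin n → ι, (∀ k, Nat.card {x // f x = k} = c k) →
      ∃ h : Perm (Fin n), f = f₀ ∘ h := by
    intro f hf
    have e : ∀ k, {x // f x = k} ≃ {x // f₀ x = k} := fun k => Fintype.equivOfCardEq (by
      rw [← Nat.card_eq_fintype_card, ← Nat.card_eq_fintype_card, hf, hf₀])
    exact ⟨Equiv.ofFiberEquiv e, funext fun x => (Equiv.ofFiberEquiv_map e x).symm⟩
  choose H hH using hperm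
  have hfib : ∀ g : Perm (Fin n), ∀ k, Nat.card {x // (f₀ ∘ g) x = k} = c k := by
    intro g k
    rw [← hf₀ k]
    exact Nat.card_congr (g.subtypeEquiv fun x => Iff.rfl)
  unfold colorChar
  norm_cast
  have hperm_card : n.factorial = Nat.card (Perm (Fin n)) := by
    rw [Nat.card_perm, Nat.card_eq_fintype_card, Fintype.card_fin]
  rw [← Nat.card_sigma, hperm_card]
  have hcomp : ∀ (f : Fin n → ι) (hf : ∀ k, Nat.card {x // f x = k} = c k) (g : Perm (Fin n)),
      (∀ x, f (g x) = f x) → f₀ ∘ (H f hf * g) = f := by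
    intro f hf g hg
    ext x
    have := congrFun (hH f hf) (g x)
    simp only [Function.comp_apply] at this
    simp only [Function.comp_apply, Perm.mul_apply, ← this, hg]
  refine Nat.card_congr (Equiv.ofBijective (fun p => H p.2.1 p.2.2.1 * p.1) ⟨?_, ?_⟩)
  · rintro ⟨g, f, hf, hg⟩ ⟨g', f', hf', hg'⟩ h
    have hff : f = f' := by
      rw [← hcomp f hf g hg, ← hcomp f' hf' g' hg']
      exact congrArg (fun p : Perm (Fin n) => f₀ ∘ p) h
    subst hff
    have hgg : g = g' := mul_left_cancel h
    subst hgg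
    rfl
  · intro g
    refine ⟨⟨(H (f₀ ∘ g) (hfib g))⁻¹ * g, f₀ ∘ g, hfib g, fun x => ?_⟩, ?_⟩
    · have := congrFun (hH (f₀ ∘ g) (hfib g)) (((H (f₀ ∘ g) (hfib g))⁻¹ * g) x)
      rw [this]
      simp
    · simp

lemma innerChar_comm (n : ℕ) (χ ψ : Perm (Fin n) → ℚ) : innerChar n χ ψ = innerChar n ψ χ := by
  simp only [innerChar, mul_comm]

lemma innerChar_sum_right {n : ℕ} {ι : Type*} (s : Finset ι) (w : ι → ℚ)
    (χ : Perm (Fin n) → ℚ) (ψ : ι → Perm (Fin n) → ℚ) :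
    innerChar n χ (fun g => ∑ i ∈ s, w i * ψ i g) = ∑ i ∈ s, w i * innerChar n χ (ψ i) := by
  simp only [innerChar, Finset.mul_sum, Finset.sum_div]
  rw [Finset.sum_comm]
  refine Finset.sum_congr rfl fun i _ => Finset.sum_congr rfl fun g _ => ?_
  ring

lemma innerChar_sum_left {n : ℕ} {ι : Type*} (s : Finset ι) (w : ι → ℚ)
    (χ : Perm (Fin n) → ℚ) (ψ : ι → Perm (Fin n) → ℚ) :
    innerChar n (fun g => ∑ i ∈ s, w i * ψ i g) χ = ∑ i ∈ s, w i * innerChar n (ψ i) χ := by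
  rw [innerChar_comm, innerChar_sum_right]
  simp only [innerChar_comm]

lemma innerChar_sub_left {n : ℕ} (χ ψ ξ : Perm (Fin n) → ℚ) :
    innerChar n (fun g => χ g - ψ g) ξ = innerChar n χ ξ - innerChar n ψ ξ := by
  simp only [innerChar, sub_mul, Finset.sum_sub_distrib, sub_div]

lemma eq_zero_of_innerChar_self {n : ℕ} {χ : Perm (Fin n) → ℚ} (h : innerChar n χ χ = 0)
    (g : Perm (Fin n)) : χ g = 0 := by
  rw [innerChar, div_eq_zero_iff, Finset.sum_eq_zero_iff_of_nonneg] at h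
  · rcases h with h | h
    · exact mul_self_eq_zero.1 (h g (Finset.mem_univ g))
    · exact absurd h (by positivity)
  · exact fun g _ => mul_self_nonneg _

lemma sum_margin {n : ℕ} {c d : Fin n → ℕ} {A : Fin n → Fin n → ℕ} (hA : A ∈ marginSet c d) :
    ∑ p, Function.uncurry A p = ∑ i, c i := by
  rw [Fintype.sum_prod_type]
  exact Finset.sum_congr rfl fun i _ => (mem_marginSet.1 hA).1 i

lemma innerChar_colorChar {n : ℕ} {c : Fin n → ℕ} (hc : ∑ i, c i = n) (d : Fin n → ℕ) :
    innerChar n (colorChar n c) (colorChar n d) = (marginSet c d).card := by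
  simp only [innerChar, colorChar_mul]
  rw [Finset.sum_comm, Finset.sum_congr rfl fun A hA =>
    sum_colorChar ((sum_margin hA).trans hc)]
  rw [Finset.sum_const, nsmul_eq_mul, mul_div_assoc, div_self, mul_one]
  exact_mod_cast n.factorial_ne_zero

/-- `colorChar` for integer vectors: zero if some entry is negative. -/
noncomputable def colorCharZ (n : ℕ) (c : Fin n → ℤ) (g : Perm (Fin n)) : ℚ :=
  if ∀ k, 0 ≤ c k then colorChar n (fun k => (c k).toNat) g else 0

lemma colorCharZ_of_neg {n : ℕ} {c : Fin n → ℤ} {i : Fin n} (h : c i < 0) :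
    colorCharZ n c = fun _ => 0 := by
  ext g
  exact if_neg fun h' => absurd (h' i) (by omega)

lemma colorCharZ_natCast {n : ℕ} (c : Fin n → ℕ) :
    colorCharZ n (fun i => (c i : ℤ)) = colorChar n c := by
  ext g
  simp [colorCharZ]

lemma innerChar_colorChar_colorCharZ {n : ℕ} {γ : Fin n → ℕ} (hγ : ∑ i, γ i = n) (c : Fin n → ℤ) :
    innerChar n (colorChar n γ) (colorCharZ n c) = matCount (extc γ) n c := by
  by_cases h : ∀ k, 0 ≤ c k
  · obtain ⟨d, rfl⟩ : ∃ d : Fin n → ℕ, c = fun i => (d i : ℤ) :=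
      ⟨fun i => (c i).toNat, funext fun i => (Int.toNat_of_nonneg (h i)).symm⟩
    have hset : marginSet γ d = {A ∈ Fintype.piFinset fun r : Fin n =>
        Finset.piAntidiag (Finset.univ : Finset (Fin n)) (extc γ r) |
          ∀ j, ∑ r, (A r j : ℤ) = d j} := by
      ext A
      simp only [marginSet, extc_val, Finset.mem_filter, ← Nat.cast_sum, Nat.cast_inj]
    rw [colorCharZ_natCast, innerChar_colorChar hγ, matCount_eq_card, hset, Int.cast_natCast]
  · push Not at h
    obtain ⟨i, hi⟩ := h
    rw [colorCharZ_of_neg hi, matCount_of_neg _ _ _ i hi]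
    simp [innerChar]

lemma irrChar_extc {n : ℕ} (ν : Fin n → ℕ) :
    irrChar n (extc ν) = fun g => ∑ σ : Perm (Fin n), ((Perm.sign σ : ℤ) : ℚ) *
      colorCharZ n (fun i => (ν i : ℤ) - (i : ℕ) + ((σ i : ℕ) : ℤ)) g := by
  ext g
  unfold irrChar
  refine Finset.sum_congr rfl fun σ _ => ?_
  congr 1
  unfold permCharZ colorCharZ
  set d : ℕ → ℤ := fun i => if h : i < n then (extc ν i : ℤ) - i + ((σ ⟨i, h⟩ : Fin n) : ℕ) else 0
    with hd
  have hdi : ∀ i : Fin n, d i = (ν i : ℤ) - (i : ℕ) + ((σ i : ℕ) : ℤ) := by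
    intro i
    simp [hd, extc_val]
  have hd0 : ∀ i, ¬ i < n → d i = 0 := fun i hi => dif_neg hi
  have hiff : (∀ k, 0 ≤ d k) ↔ ∀ i : Fin n, 0 ≤ (ν i : ℤ) - (i : ℕ) + ((σ i : ℕ) : ℤ) := by
    simp only [← hdi]
    refine ⟨fun h i => h i, fun h k => ?_⟩
    by_cases hk : k < n
    · exact h ⟨k, hk⟩
    · exact (hd0 k hk).ge
  by_cases h : ∀ k, 0 ≤ d k
  · rw [if_pos h, if_pos (hiff.1 h)]
    change colorChar n (fun k => (d k).toNat) g = _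
    rw [← colorChar_comp_embedding Fin.valEmbedding]
    · congr 1
      ext i
      simp [hdi]
    · intro k hk
      rw [hd0 k fun hlt => hk ⟨⟨k, hlt⟩, rfl⟩]
      rfl
  · rw [if_neg h, if_neg fun h' => h (hiff.2 h')]

lemma innerChar_colorChar_irrChar {n : ℕ} {γ ν : Fin n → ℕ} (hγ : ∑ i, γ i = n)
    (hν : Antitone ν) :
    innerChar n (colorChar n γ) (irrChar n (extc ν)) = stripChains (extc γ) n ν := by
  rw [irrChar_extc, innerChar_sum_right]
  simp only [innerChar_colorChar_colorCharZ hγ]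
  have := altCount_eq_stripChains (extc γ) n hν
  unfold altCount at this
  exact_mod_cast this

lemma sum_range_extc {n : ℕ} (ν : Fin n → ℕ) (k : ℕ) :
    ∑ i ∈ Finset.range k, extc ν i =
      ∑ i ∈ Finset.univ.filter (fun i : Fin n => (i : ℕ) < k), ν i := by
  rw [Finset.sum_filter]
  have h1 : ∀ i : Fin n, (if (i : ℕ) < k then ν i else 0) =
      (fun i : ℕ => if i < k then extc ν i else 0) i := fun i => by simp only [extc_val]
  rw [Finset.sum_congr rfl fun i _ => h1 i,
    Fin.sum_univ_eq_sum_range (fun i : ℕ => if i < k then extc ν i else 0) n,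
    ← Finset.sum_filter]
  symm
  refine Finset.sum_subset_zero_on_sdiff ?_ ?_ fun _ _ => rfl
  · intro i hi
    simpa using (Finset.mem_filter.1 hi).2
  · intro i hi
    simp only [Finset.mem_sdiff, Finset.mem_range, Finset.mem_filter, not_and, not_lt] at hi
    refine extc_of_le ν ?_
    by_contra hc
    have := hi.2 (by omega)
    omega

lemma dominates_of_stripChains_ne_zero {n : ℕ} {γ ν : Fin n → ℕ}
    (h : stripChains (extc γ) n ν ≠ 0) : Dominates (extc ν) (extc γ) := by
  obtain ⟨-, -, h3⟩ := stripChains_ne_zero h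
  intro k
  rw [sum_range_extc ν]
  by_cases hk : k ≤ n
  · exact h3 k hk
  · have h4 := h3 n le_rfl
    rw [sum_range_extc] at h4 ⊢
    have : Finset.univ.filter (fun i : Fin n => (i : ℕ) < k) =
        Finset.univ.filter (fun i : Fin n => (i : ℕ) < n) :=
      Finset.filter_congr fun i _ => by have := i.isLt; omega
    rwa [this]

lemma extc_eq_of_dominates {n : ℕ} {α β : Fin n → ℕ} (h : Dominates (extc α) (extc β))
    (h' : Dominates (extc β) (extc α)) : α = β := by
  ext i
  have h1 := (h i).antisymm (h' i)
  have h2 := (h (i + 1)).antisymm (h' (i + 1))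
  rw [Finset.sum_range_succ, Finset.sum_range_succ, h1] at h2
  simpa [extc_val] using h2.symm

lemma sum_id_le_sum_perm {n : ℕ} (σ : Perm (Fin n)) (k : ℕ) :
    ∑ i ∈ Finset.univ.filter (fun i : Fin n => (i : ℕ) < k), (i : ℕ) ≤
      ∑ i ∈ Finset.univ.filter (fun i : Fin n => (i : ℕ) < k), (σ i : ℕ) := by
  have h : Antivary (fun i : Fin n => if (i : ℕ) < k then 1 else 0) (fun i : Fin n => (i : ℕ)) := by
    intro i j hij
    simp only at hij ⊢
    split_ifs <;> omega
  have := h.sum_mul_le_sum_mul_comp_perm (σ := σ)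
  simpa [Finset.sum_filter] using this

lemma eq_one_of_sum_perm_le {n : ℕ} {σ : Perm (Fin n)}
    (h : ∀ k, ∑ i ∈ Finset.univ.filter (fun i : Fin n => (i : ℕ) < k), (σ i : ℕ) ≤
      ∑ i ∈ Finset.univ.filter (fun i : Fin n => (i : ℕ) < k), (i : ℕ)) : σ = 1 := by
  have : (fun i => (σ i : ℕ)) = fun i : Fin n => (i : ℕ) := by
    refine extc_eq_of_dominates (fun k => ?_) (fun k => ?_)
    · rw [sum_range_extc, sum_range_extc]
      exact sum_id_le_sum_perm σ k
    · rw [sum_range_extc, sum_range_extc]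
      exact h k
  ext i
  exact congrFun this i

lemma stripChains_extc_self {n : ℕ} {ν : Fin n → ℕ} (hν : Antitone ν) :
    stripChains (extc ν) n ν = 1 := by
  have := stripChains_self (antitone_extc hν) (le_refl n)
  simpa [extc_val] using this

lemma sum_shift_perm {n : ℕ} {β : Fin n → ℕ} {σ : Perm (Fin n)} {c : Fin n → ℕ}
    (hc : ∀ i, (c i : ℤ) = (β i : ℤ) - (i : ℕ) + ((σ i : ℕ) : ℤ)) : ∑ i, c i = ∑ i, β i := by
  have h1 : ∑ i, (c i : ℤ) = ∑ i, ((β i : ℤ) - (i : ℕ) + ((σ i : ℕ) : ℤ)) :=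
    Finset.sum_congr rfl fun i _ => hc i
  rw [Finset.sum_add_distrib, Finset.sum_sub_distrib,
    Equiv.sum_comp σ (fun i => ((i : ℕ) : ℤ))] at h1
  have h2 : ∑ i, (c i : ℤ) = ∑ i, (β i : ℤ) := by linarith
  exact_mod_cast h2

lemma sum_filter_shift_perm {n : ℕ} {β : Fin n → ℕ} {σ : Perm (Fin n)} {c : Fin n → ℕ}
    (hc : ∀ i, (c i : ℤ) = (β i : ℤ) - (i : ℕ) + ((σ i : ℕ) : ℤ)) (s : Finset (Fin n)) :
    ∑ i ∈ s, c i + ∑ i ∈ s, (i : ℕ) = ∑ i ∈ s, β i + ∑ i ∈ s, (σ i : ℕ) := by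
  rw [← Finset.sum_add_distrib, ← Finset.sum_add_distrib]
  exact Finset.sum_congr rfl fun i _ => by have := hc i; omega

lemma exists_natCast_of_colorCharZ {n : ℕ} {β : Fin n → ℕ} {σ : Perm (Fin n)}
    (h : colorCharZ n (fun i => (β i : ℤ) - (i : ℕ) + ((σ i : ℕ) : ℤ)) ≠ fun _ => 0) :
    ∃ c : Fin n → ℕ, (∀ i, (c i : ℤ) = (β i : ℤ) - (i : ℕ) + ((σ i : ℕ) : ℤ)) ∧
      colorCharZ n (fun i => (β i : ℤ) - (i : ℕ) + ((σ i : ℕ) : ℤ)) = colorChar n c := by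
  have hnn : ∀ i, 0 ≤ (β i : ℤ) - (i : ℕ) + ((σ i : ℕ) : ℤ) := by
    intro i
    by_contra hc
    exact h (colorCharZ_of_neg (i := i) (by omega))
  have hc : ∀ i, (((β i : ℤ) - (i : ℕ) + ((σ i : ℕ) : ℤ)).toNat : ℤ) =
      (β i : ℤ) - (i : ℕ) + ((σ i : ℕ) : ℤ) := fun i => Int.toNat_of_nonneg (hnn i)
  refine ⟨_, hc, ?_⟩
  rw [← colorCharZ_natCast]
  congr 1
  ext i
  exact (hc i).symm

lemma innerChar_irrChar_colorCharZ {n : ℕ} {α β : Fin n → ℕ} (hα : Antitone α)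
    (hβn : ∑ i, β i = n) {σ : Perm (Fin n)}
    (h : innerChar n (irrChar n (extc α))
      (colorCharZ n (fun i => (β i : ℤ) - (i : ℕ) + ((σ i : ℕ) : ℤ))) ≠ 0) :
    Dominates (extc α) (extc β) ∧ (α = β → σ = 1) := by
  obtain ⟨c, hc, hcc⟩ := exists_natCast_of_colorCharZ (β := β) (σ := σ) (by
    intro h0
    rw [h0] at h
    simp [innerChar] at h)
  rw [hcc, innerChar_comm, innerChar_colorChar_irrChar ((sum_shift_perm hc).trans hβn) hα] at h
  have hdom := dominates_of_stripChains_ne_zero (by exact_mod_cast h)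
  refine ⟨fun k => ?_, ?_⟩
  · have h1 := hdom k
    have h2 := sum_filter_shift_perm hc (Finset.univ.filter (fun i : Fin n => (i : ℕ) < k))
    have h3 := sum_id_le_sum_perm σ k
    rw [sum_range_extc, sum_range_extc] at h1 ⊢
    omega
  · rintro rfl
    refine eq_one_of_sum_perm_le fun k => ?_
    have h1 := hdom k
    have h2 := sum_filter_shift_perm hc (Finset.univ.filter (fun i : Fin n => (i : ℕ) < k))
    rw [sum_range_extc, sum_range_extc] at h1
    omega

theorem innerChar_irrChar {n : ℕ} {α β : Fin n → ℕ} (hα : Antitone α) (hβ : Antitone β)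
    (hαn : ∑ i, α i = n) (hβn : ∑ i, β i = n) :
    innerChar n (irrChar n (extc α)) (irrChar n (extc β)) = if α = β then 1 else 0 := by
  have hdom : ∀ {α β : Fin n → ℕ}, Antitone α → ∑ i, β i = n →
      innerChar n (irrChar n (extc α)) (irrChar n (extc β)) ≠ 0 →
      Dominates (extc α) (extc β) := by
    intro α β hα hβn h
    rw [irrChar_extc β, innerChar_sum_right] at h
    obtain ⟨σ, -, hσ⟩ := Finset.exists_ne_zero_of_sum_ne_zero h
    exact (innerChar_irrChar_colorCharZ hα hβn (right_ne_zero_of_mul hσ)).1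
  split_ifs with h
  · subst h
    nth_rewrite 2 [irrChar_extc α]
    rw [innerChar_sum_right, Finset.sum_eq_single 1]
    · have : (fun i : Fin n => (α i : ℤ) - (i : ℕ) + (((1 : Perm (Fin n)) i : ℕ) : ℤ)) =
          fun i => (α i : ℤ) := by
        ext i
        simp
      rw [this, colorCharZ_natCast, innerChar_comm, innerChar_colorChar_irrChar hαn hα,
        stripChains_extc_self hα]
      simp
    · intro σ _ hσ
      by_contra h
      exact hσ ((innerChar_irrChar_colorCharZ hα hαn (right_ne_zero_of_mul h)).2 rfl)
    · simp
  · by_contra h0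
    refine h (extc_eq_of_dominates (hdom hα hβn h0) (hdom hβ hαn ?_))
    rwa [innerChar_comm]

lemma length_sort_parts_le {n : ℕ} (P : n.Partition) :
    (P.parts.sort (· ≤ ·)).reverse.length ≤ n := by
  have := Multiset.card_nsmul_le_sum (s := P.parts) (a := 1) fun x hx => P.parts_pos hx
  rw [P.parts_sum, smul_eq_mul, mul_one] at this
  simpa using this

lemma pf_eq_extc {n : ℕ} (P : n.Partition) : pf P = extc (pfin P) := by
  ext i
  by_cases hi : i < n
  · exact (extc_val (pfin P) ⟨i, hi⟩).symm
  · rw [extc_of_le (pfin P) (not_lt.1 hi), pf, List.getD_eq_default]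
    have := length_sort_parts_le P
    omega

lemma pfin_antitone {n : ℕ} (P : n.Partition) : Antitone (pfin P) := by
  intro i j hij
  have hs : (P.parts.sort (· ≤ ·)).reverse.Pairwise (· ≥ ·) :=
    List.pairwise_reverse.2 (P.parts.pairwise_sort (· ≤ ·))
  simp only [pfin, pf]
  by_cases hj : (j : ℕ) < (P.parts.sort (· ≤ ·)).reverse.length
  · rw [List.getD_eq_getElem _ _ hj, List.getD_eq_getElem _ _ (lt_of_le_of_lt hij hj)]
    exact hs.rel_get_of_le (a := ⟨i, lt_of_le_of_lt hij hj⟩) (b := ⟨j, hj⟩) hij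
  · rw [List.getD_eq_default _ _ (not_lt.1 hj)]
    exact Nat.zero_le _

lemma filter_map_pfin {n : ℕ} (P : n.Partition) :
    (Finset.univ.val.map (pfin P)).filter (· ≠ 0) = P.parts := by
  set l := (P.parts.sort (· ≤ ·)).reverse with hl
  have hofFn : List.ofFn (pfin P) = l ++ List.replicate (n - l.length) 0 := by
    refine List.ext_getElem ?_ fun i hi _ => ?_
    · have : l.length ≤ n := length_sort_parts_le P
      simp only [List.length_ofFn, List.length_append, List.length_replicate]
      omega
    · rw [List.getElem_ofFn, List.getElem_append]
      split_ifs with h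
      · exact List.getD_eq_getElem _ _ h
      · rw [List.getElem_replicate]
        exact List.getD_eq_default _ _ (not_lt.1 h)
  have hcoe : (l : Multiset ℕ) = P.parts := by
    rw [hl, ← Multiset.coe_reverse, List.reverse_reverse, Multiset.sort_eq]
  rw [Fin.univ_val_map, hofFn, ← Multiset.coe_add, Multiset.filter_add, hcoe,
    Multiset.filter_eq_self.2 fun x hx => (P.parts_pos hx).ne', Multiset.coe_replicate,
    Multiset.filter_eq_nil.2 fun x hx => not_not.2 (Multiset.eq_of_mem_replicate hx), add_zero]

lemma pfin_injective {n : ℕ} : Function.Injective (pfin (n := n)) := by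
  intro P Q h
  ext1
  rw [← filter_map_pfin P, h, filter_map_pfin Q]

lemma sum_comp_eq_of_parts_eq {ι : Type*} [Fintype ι] (c : ι → ℕ) {f : ℕ → ℕ} (hf : f 0 = 0) :
    ∑ i, f (c i) = (((Finset.univ.val.map c).filter (· ≠ 0)).map f).sum := by
  have h := Multiset.filter_add_not (· ≠ 0) (Finset.univ.val.map c)
  have h0 : ((Finset.univ.val.map c).filter (¬ · ≠ 0)).map f =
      ((Finset.univ.val.map c).filter (¬ · ≠ 0)).map fun _ => 0 :=
    Multiset.map_congr rfl fun x hx => by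
      rw [not_not.1 (Multiset.mem_filter.1 hx).2, hf]
  rw [Finset.sum, ← Function.comp_def, ← Multiset.map_map, ← h, Multiset.map_add,
    Multiset.sum_add, h0, h]
  simp

lemma sum_pfin {n : ℕ} (P : n.Partition) : ∑ i, pfin P i = n := by
  have := sum_comp_eq_of_parts_eq (pfin P) (f := fun x => x) rfl
  rwa [filter_map_pfin, Multiset.map_id', P.parts_sum] at this

lemma exists_partition_parts_eq {n : ℕ} {ι : Type*} [Fintype ι] {c : ι → ℕ}
    (hc : ∑ i, c i = n) :
    ∃ P : n.Partition, (Finset.univ.val.map c).filter (· ≠ 0) = P.parts :=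
  ⟨Nat.Partition.ofSums n (Finset.univ.val.map c) hc, by
    simp [Nat.Partition.ofSums]⟩

lemma exists_partition_colorChar_eq {n : ℕ} {c : Fin n → ℕ} (hc : ∑ i, c i = n) :
    ∃ P : n.Partition, colorChar n c = colorChar n (pfin P) ∧
      ∑ i, c i ^ 2 = ∑ i, pfin P i ^ 2 := by
  obtain ⟨P, hP⟩ := exists_partition_parts_eq hc
  refine ⟨P, colorChar_eq_of_parts_eq ?_, ?_⟩
  · rw [hP, filter_map_pfin]
  · rw [sum_comp_eq_of_parts_eq c (f := (· ^ 2)) rfl, hP,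
      sum_comp_eq_of_parts_eq (pfin P) (f := (· ^ 2)) rfl, filter_map_pfin]

lemma sum_sq_lt_sum_sq_shift_perm {n : ℕ} {β : Fin n → ℕ} (hβ : Antitone β)
    {σ : Perm (Fin n)} (hσ : σ ≠ 1) {c : Fin n → ℕ}
    (hc : ∀ i, (c i : ℤ) = (β i : ℤ) - (i : ℕ) + ((σ i : ℕ) : ℤ)) :
    ∑ i, β i ^ 2 < ∑ i, c i ^ 2 := by
  have hanti : Antivary (fun i : Fin n => (β i : ℤ)) (fun i : Fin n => ((i : ℕ) : ℤ)) :=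
    fun i j hij => by
      have : i < j := by simpa using hij
      simpa using hβ this.le
  have h1 := hanti.sum_mul_le_sum_mul_comp_perm (σ := σ)
  have h2 : 0 < ∑ i : Fin n, (((σ i : ℕ) : ℤ) - (i : ℕ)) ^ 2 := by
    obtain ⟨i, hi⟩ : ∃ i, σ i ≠ i := by
      by_contra! h
      exact hσ (Equiv.ext h)
    refine Finset.sum_pos' (fun i _ => sq_nonneg _) ⟨i, Finset.mem_univ i, ?_⟩
    have : ((σ i : ℕ) : ℤ) - (i : ℕ) ≠ 0 := fun h => hi (Fin.ext (by omega))
    positivity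
  have h3 : ∑ i, (c i : ℤ) ^ 2 = ∑ i, (β i : ℤ) ^ 2 +
      2 * (∑ i, (β i : ℤ) * ((σ i : ℕ) : ℤ) - ∑ i, (β i : ℤ) * ((i : ℕ) : ℤ)) +
      ∑ i : Fin n, (((σ i : ℕ) : ℤ) - (i : ℕ)) ^ 2 := by
    rw [← Finset.sum_sub_distrib, Finset.mul_sum, ← Finset.sum_add_distrib,
      ← Finset.sum_add_distrib]
    exact Finset.sum_congr rfl fun i _ => by rw [hc]; ring
  have h4 : ∑ i, (β i : ℤ) ^ 2 < ∑ i, (c i : ℤ) ^ 2 := by linarith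
  exact_mod_cast h4

lemma innerChar_colorChar_eq_zero {n : ℕ} {f : Perm (Fin n) → ℚ}
    (hf : ∀ β : n.Partition, innerChar n f (irrChar n (pf β)) = 0) {c : Fin n → ℕ}
    (hc : ∑ i, c i = n) : innerChar n f (colorChar n c) = 0 := by
  have hbound : ∀ c : Fin n → ℕ, ∑ i, c i = n → ∑ i, c i ^ 2 ≤ n ^ 2 := by
    intro c hc
    conv_rhs => rw [← hc]
    exact Finset.sum_sq_le_sq_sum_of_nonneg fun _ _ => Nat.zero_le _
  induction hk : n ^ 2 - ∑ i, c i ^ 2 using Nat.strong_induction_on generalizing c with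
  | _ k ih =>
    obtain ⟨P, hP, hPsq⟩ := exists_partition_colorChar_eq hc
    have h := hf P
    rw [pf_eq_extc, irrChar_extc, innerChar_sum_right, Finset.sum_eq_single 1] at h
    · have h1 : (fun i : Fin n => (pfin P i : ℤ) - (i : ℕ) + (((1 : Perm (Fin n)) i : ℕ) : ℤ)) =
          fun i => (pfin P i : ℤ) := by
        ext i
        simp
      rw [h1, colorCharZ_natCast] at h
      simpa [hP] using h
    · intro σ _ hσ
      by_cases h0 : colorCharZ n (fun i => (pfin P i : ℤ) - (i : ℕ) + ((σ i : ℕ) : ℤ)) =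
          fun _ => 0
      · rw [h0]
        simp [innerChar]
      · obtain ⟨d, hd, hdc⟩ := exists_natCast_of_colorCharZ h0
        have hdn : ∑ i, d i = n := (sum_shift_perm hd).trans (sum_pfin P)
        have hlt := sum_sq_lt_sum_sq_shift_perm (pfin_antitone P) hσ hd
        have hle := hbound d hdn
        rw [hdc, ih _ (by omega) hdn rfl, mul_zero]
    · simp

/-- Young's rule. -/
theorem colorChar_eq_sum_irrChar {n : ℕ} {γ : Fin n → ℕ} (hγ : ∑ i, γ i = n) :
    colorChar n γ = fun g => ∑ α : n.Partition,
      (stripChains (extc γ) n (pfin α) : ℚ) * irrChar n (pf α) g := by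
  set ψ : Perm (Fin n) → ℚ := fun g => ∑ α : n.Partition,
      (stripChains (extc γ) n (pfin α) : ℚ) * irrChar n (pf α) g with hψ
  set f : Perm (Fin n) → ℚ := fun g => colorChar n γ g - ψ g with hf
  have hirr : ∀ β : n.Partition, innerChar n f (irrChar n (pf β)) = 0 := by
    intro β
    rw [hf, innerChar_sub_left, hψ, innerChar_sum_left, pf_eq_extc,
      innerChar_colorChar_irrChar hγ (pfin_antitone β), Finset.sum_eq_single β]
    · rw [pf_eq_extc, innerChar_irrChar (pfin_antitone β) (pfin_antitone β) (sum_pfin β)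
        (sum_pfin β)]
      simp
    · intro α _ hα
      rw [pf_eq_extc, innerChar_irrChar (pfin_antitone α) (pfin_antitone β) (sum_pfin α)
        (sum_pfin β), if_neg fun h => hα (pfin_injective h), mul_zero]
    · simp
  have hself : innerChar n f f = 0 := by
    rw [hf, innerChar_sub_left, ← hf, innerChar_comm, innerChar_colorChar_eq_zero hirr hγ, hψ,
      innerChar_sum_left, Finset.sum_eq_zero, sub_zero]
    intro α _
    rw [innerChar_comm, hirr, mul_zero]
  ext g
  exact sub_eq_zero.1 (eq_zero_of_innerChar_self hself g)

lemma kostka_pf {n : ℕ} (α γ : n.Partition) :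
    kostka (pf α) (pf γ) = stripChains (pf γ) n (pfin α) := by
  rw [pf_eq_extc α]
  refine kostka_extc (fun k hk => ?_) (pfin_antitone α)
  rw [pf_eq_extc]
  exact extc_of_le _ hk

lemma stripChains_eq_zero_of_not_dominates {n : ℕ} {α γ : n.Partition}
    (h : ¬ Dominates (pf α) (pf γ)) : stripChains (pf γ) n (pfin α) = 0 := by
  by_contra h0
  rw [pf_eq_extc, pf_eq_extc] at h
  rw [pf_eq_extc] at h0
  exact h (dominates_of_stripChains_ne_zero h0)

lemma innerChar_mul_colorChar {n : ℕ} (lam mu : n.Partition) (χ : Perm (Fin n) → ℚ) :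
    innerChar n (fun g => colorChar n (pfin lam) g * colorChar n (pfin mu) g) χ =
      ∑ α : n.Partition, ∑ β : n.Partition,
        (stripChains (pf lam) n (pfin α) : ℚ) * (stripChains (pf mu) n (pfin β) : ℚ) *
          innerChar n (fun g => irrChar n (pf α) g * irrChar n (pf β) g) χ := by
  rw [colorChar_eq_sum_irrChar (sum_pfin lam), colorChar_eq_sum_irrChar (sum_pfin mu)]
  simp only [← pf_eq_extc, Finset.sum_mul_sum, ← Finset.sum_product']
  rw [← innerChar_sum_left]
  congr 1
  ext g
  exact Finset.sum_congr rfl fun p _ => by ring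

/-- if `ν` is minimal for `(lam, mu)`, then
`m_ν(lam,mu) = ∑_{α ⊵ lam, β ⊵ mu} K_{α lam} K_{β mu} k(α,β,ν)`. -/
theorem stmt18 (n : ℕ) (lam mu ν : n.Partition)
    (hex : ∃ A : Fin n → Fin n → ℕ,
        ((∀ i, ∑ j, A i j = pfin lam i) ∧ (∀ j, ∑ i, A i j = pfin mu j)) ∧ HasPiSeq A ν)
    (hmin : ∀ B : Fin n → Fin n → ℕ,
        ((∀ i, ∑ j, B i j = pfin lam i) ∧ (∀ j, ∑ i, B i j = pfin mu j)) →
        ∀ γ : n.Partition, HasPiSeq B γ → Dominates (pf ν) (pf γ) → γ = ν) :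
    (Nat.card {A : Fin n → Fin n → ℕ //
        ((∀ i, ∑ j, A i j = pfin lam i) ∧ (∀ j, ∑ i, A i j = pfin mu j)) ∧
          HasPiSeq A ν} : ℚ) =
      ∑ α : n.Partition, ∑ β : n.Partition,
        if Dominates (pf α) (pf lam) ∧ Dominates (pf β) (pf mu) then
          (kostka (pf α) (pf lam) : ℚ) * (kostka (pf β) (pf mu) : ℚ) *
            kron n (pf α) (pf β) (pf ν)
        else 0 := by
  rw [Finset.sum_congr rfl fun α _ => Finset.sum_congr rfl fun β _ => show
    (if Dominates (pf α) (pf lam) ∧ Dominates (pf β) (pf mu) then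
      (kostka (pf α) (pf lam) : ℚ) * (kostka (pf β) (pf mu) : ℚ) * kron n (pf α) (pf β) (pf ν)
      else 0) = (stripChains (pf lam) n (pfin α) : ℚ) * (stripChains (pf mu) n (pfin β) : ℚ) *
        innerChar n (fun g => irrChar n (pf α) g * irrChar n (pf β) g) (irrChar n (pf ν)) by
      rw [kostka_pf, kostka_pf, kron]
      split_ifs with h
      · rfl
      · rcases not_and_or.1 h with h | h <;> simp [stripChains_eq_zero_of_not_dominates h]]
  rw [← innerChar_mul_colorChar]
  simp only [colorChar_mul]
  have hterm : ∀ A ∈ marginSet (pfin lam) (pfin mu),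
      innerChar n (colorChar n (Function.uncurry A)) (irrChar n (pf ν)) =
        if HasPiSeq A ν then 1 else 0 := by
    intro A hA
    obtain ⟨P, hP⟩ := exists_partition_parts_eq ((sum_margin hA).trans (sum_pfin lam))
    rw [colorChar_eq_of_parts_eq (hP.trans (filter_map_pfin P).symm), pf_eq_extc ν,
      innerChar_colorChar_irrChar (sum_pfin P) (pfin_antitone ν)]
    have hAP : HasPiSeq A ν ↔ P = ν := by
      rw [Nat.Partition.ext_iff, ← hP]
      rfl
    split_ifs with h
    · rw [hAP.1 h, stripChains_extc_self (pfin_antitone ν), Nat.cast_one]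
    · rw [← pf_eq_extc, stripChains_eq_zero_of_not_dominates, Nat.cast_zero]
      exact fun hdom => h (hAP.2 (hmin A (mem_marginSet.1 hA) P hP hdom))
  have hsum := innerChar_sum_left (marginSet (pfin lam) (pfin mu)) (fun _ => 1)
    (irrChar n (pf ν)) fun A => colorChar n (Function.uncurry A)
  simp only [one_mul] at hsum
  rw [hsum, Finset.sum_congr rfl hterm, Finset.sum_boole, Nat.cast_inj]
  refine Nat.subtype_card _ fun A => ?_
  rw [Finset.mem_filter, mem_marginSet]
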